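/- There is c* > 0 such that for every ε ∈ (0,1] there is C₀ > 0 such that for all σ, μ ∈ (0, c*] there is C > 0 such that for every c > 0 there is n₀ ∈ ℕ with the following property for all n ≥ n₀. Let d ∈ [n] with d ≥ C·log n and dn even, let m be an integer with ε·d·n ≤ m ≤ n^{1+σ}, set δ = 2m/n, λ = max{μ²/(log n)², (n·log n/m)^{1/4}} and p = m·(binom(n,2) − dn/2)^{−1}. Let K ~ G_d(n), form E by including each element of [n]^(2)∖E(K) independently with probability p, let F = K + E, and let ℓ₀ be the smallest integer with δ^{ℓ₀−1}·d^{ℓ₀−1} ≥ n. Then with probability at least 1 − c·n^{−14}: for every pair of distinct x, y ∈ [n], every Z ⊆ [n] with |Z| ≤ 40·log n, and every integer ℓ with 10·ℓ₀ ≤ ℓ ≤ 10·log n, the number of (F∖K, K)-alternating x,y-paths of length 2ℓ with no internal vertex in Z is at least (1 − C₀·λ − |(Z ∪ {x}) ∩ N_K(y)|/d)·d^ℓ·δ^ℓ/n. (Theorem 6.1.) -/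

import Mathlib

open scoped Classical ENNReal

noncomputable section

namespace Sandwich

variable {n : ℕ}

/-- The degree of the vertex `v` in the graph `G`. -/
def deg (G : SimpleGraph (Fin n)) (v : Fin n) : ℕ := Nat.card (G.neighborSet v)

/-- `G` is a `d`-regular graph. -/
def IsRegularGraph (G : SimpleGraph (Fin n)) (d : ℕ) : Prop := ∀ v, deg G v = d

/-- The number of edges of `G`. -/
def edgeCount (G : SimpleGraph (Fin n)) : ℕ := G.edgeSet.ncard

/-- The probability of the event `P` under the probability mass function `μ`. -/
def prEvent {α : Type*} (μ : PMF α) (P : α → Prop) : ℝ≥0∞ := ∑' a, if P a then μ a else 0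

/-- `μ` is the uniform distribution on the set `S`. -/
def IsUniformOn {α : Type*} (μ : PMF α) (S : Set α) : Prop :=
  ∀ a, μ a = if a ∈ S then (S.ncard : ℝ≥0∞)⁻¹ else 0

/-- `P` lists the `k+1` vertices of a `(G₁,G₂)`-alternating path of length `k`: the vertices
are distinct and consecutive vertices are joined by an edge of `G₁` (for steps of even index)
or of `G₂` (for steps of odd index). -/
def IsAltSeq (G₁ G₂ : SimpleGraph (Fin n)) (k : ℕ) (P : Fin (k + 1) → Fin n) : Prop :=
  Function.Injective P ∧
    ∀ i : Fin k, if (i : ℕ) % 2 = 0 then G₁.Adj (P i.castSucc) (P i.succ)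
      else G₂.Adj (P i.castSucc) (P i.succ)

/-- The number of `(G₁,G₂)`-alternating `x,y`-paths of length `k` with no internal vertex
in `Z`. -/
def altPathCount (G₁ G₂ : SimpleGraph (Fin n)) (k : ℕ) (x y : Fin n) (Z : Set (Fin n)) : ℕ :=
  Nat.card {P : Fin (k + 1) → Fin n // IsAltSeq G₁ G₂ k P ∧ P 0 = x ∧ P (Fin.last k) = y ∧
    ∀ i : Fin (k + 1), i ≠ 0 → i ≠ Fin.last k → P i ∉ Z}

/-- The number of `(G₁,G₂)`-alternating paths of length `k` starting at `x`. -/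
def altStartCount (G₁ G₂ : SimpleGraph (Fin n)) (k : ℕ) (x : Fin n) : ℕ :=
  Nat.card {P : Fin (k + 1) → Fin n // IsAltSeq G₁ G₂ k P ∧ P 0 = x}

/-- The external neighbourhood `N_G(U)` of a set of vertices `U`. -/
def nbhd (G : SimpleGraph (Fin n)) (U : Set (Fin n)) : Set (Fin n) :=
  {v | v ∉ U ∧ ∃ u ∈ U, G.Adj u v}

/-- `e_G(U)`, the number of edges of `G` with both endpoints in `U`. -/
def edgesWithin (G : SimpleGraph (Fin n)) (U : Set (Fin n)) : ℕ :=
  {e ∈ G.edgeSet | ∀ v ∈ e, v ∈ U}.ncard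

/-- `e_G(U,V) = |{(u,v) : u ∈ U, v ∈ V, uv ∈ E(G)}|`. -/
def edgesBetween (G : SimpleGraph (Fin n)) (U V : Set (Fin n)) : ℕ :=
  {p : Fin n × Fin n | p.1 ∈ U ∧ p.2 ∈ V ∧ G.Adj p.1 p.2}.ncard

/-- `|E_{≥2,G}(U)|`, the number of edges `xy ∈ E(G)` with `x ∈ U`, `y ∉ U` such that some
`x' ∈ U ∖ {x}` also satisfies `x'y ∈ E(G)`. -/
def E2count (G : SimpleGraph (Fin n)) (U : Set (Fin n)) : ℕ :=
  {e : Sym2 (Fin n) | e ∈ G.edgeSet ∧ ∃ x y, e = s(x, y) ∧ x ∈ U ∧ y ∉ U ∧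
    ∃ x' ∈ U, x' ≠ x ∧ G.Adj x' y}.ncard

/-- `Σ_{u ∈ N_{F∖K}(v)} Σ_{u' ∈ N_K(u)} d_{F∖K}(u')`. -/
def doubleDegSum (F K : SimpleGraph (Fin n)) (v : Fin n) : ℝ :=
  ∑ u : Fin n, if (F \ K).Adj v u then
    ∑ u' : Fin n, if K.Adj u u' then (deg (F \ K) u' : ℝ) else 0
  else 0

/-- `μ` is the law of the binomial random graph `G(n,p)`. -/
def IsGnp (μ : PMF (SimpleGraph (Fin n))) (p : ℝ) : Prop :=
  ∀ G, μ G = ENNReal.ofReal (p ^ edgeCount G * (1 - p) ^ (n.choose 2 - edgeCount G))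

/-- `μ` is the law of `G(n,p)`, where `p` is truncated to `[0,1]` (so that `G(n,p)` is the
empty graph for `p ≤ 0` and the complete graph for `p ≥ 1`). -/
def IsGnpLaw (μ : PMF (SimpleGraph (Fin n))) (p : ℝ) : Prop :=
  IsGnp μ (max 0 (min p 1))

/-- `μ` is the law of `K + E`, where `E` includes each pair not in `E(K)` independently with
probability `p`. -/
def IsAddGnp (μ : PMF (SimpleGraph (Fin n))) (K : SimpleGraph (Fin n)) (p : ℝ) : Prop :=
  ∀ F, μ F = if K ≤ F then
      ENNReal.ofReal (p ^ (edgeCount F - edgeCount K) * (1 - p) ^ (n.choose 2 - edgeCount F))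
    else 0

/-- `ν` is the joint law of `(K, F)` where `K ~ G_d(n)` is a uniformly random `d`-regular graph
and `F = K + E`, `E` including each pair not in `E(K)` independently with probability `p`. -/
def IsRegAddGnp (ν : PMF (SimpleGraph (Fin n) × SimpleGraph (Fin n))) (d : ℕ) (p : ℝ) : Prop :=
  ∀ w, ν w = if IsRegularGraph w.1 d ∧ w.1 ≤ w.2 then
      ({G : SimpleGraph (Fin n) | IsRegularGraph G d}.ncard : ℝ≥0∞)⁻¹ *
        ENNReal.ofReal (p ^ (edgeCount w.2 - edgeCount w.1) *
          (1 - p) ^ (n.choose 2 - edgeCount w.2))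
    else 0

/-- `ν` is the joint law of an independent pair `(K, F)` with `K ~ G_d(n)` and `F ~ G(n,q)`. -/
def IsRegIndepGnp (ν : PMF (SimpleGraph (Fin n) × SimpleGraph (Fin n))) (d : ℕ) (q : ℝ) :
    Prop :=
  ∀ w, ν w = (if IsRegularGraph w.1 d then
      ({G : SimpleGraph (Fin n) | IsRegularGraph G d}.ncard : ℝ≥0∞)⁻¹ else 0) *
      ENNReal.ofReal (q ^ edgeCount w.2 * (1 - q) ^ (n.choose 2 - edgeCount w.2))


section ProductMeasure

open Finset

variable {ι : Type*} [Fintype ι] [DecidableEq ι]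

/-- The weight of `ω` when each `e` belongs to the random set independently with probability
`p e`. -/
def bernoulliWeight (p : ι → ℝ) (ω : Finset ι) : ℝ := ∏ e, if e ∈ ω then p e else 1 - p e

/-- The expectation of `f` over a random set containing each `e` independently with probability
`p e`. -/
def expect (p : ι → ℝ) (f : Finset ι → ℝ) : ℝ := ∑ ω, bernoulliWeight p ω * f ω

lemma bernoulliWeight_nonneg {p : ι → ℝ} (h0 : ∀ e, 0 ≤ p e) (h1 : ∀ e, p e ≤ 1)
    (ω : Finset ι) : 0 ≤ bernoulliWeight p ω := by
  refine prod_nonneg fun e _ => ?_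
  split_ifs
  · exact h0 e
  · linarith [h1 e]

lemma expect_mono {p : ι → ℝ} (h0 : ∀ e, 0 ≤ p e) (h1 : ∀ e, p e ≤ 1)
    {f g : Finset ι → ℝ} (h : ∀ ω, f ω ≤ g ω) : expect p f ≤ expect p g :=
  sum_le_sum fun ω _ => mul_le_mul_of_nonneg_left (h ω) (bernoulliWeight_nonneg h0 h1 ω)

lemma expect_nonneg {p : ι → ℝ} (h0 : ∀ e, 0 ≤ p e) (h1 : ∀ e, p e ≤ 1)
    {f : Finset ι → ℝ} (h : ∀ ω, 0 ≤ f ω) : 0 ≤ expect p f :=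
  sum_nonneg fun ω _ => mul_nonneg (bernoulliWeight_nonneg h0 h1 ω) (h ω)

lemma expect_add (p : ι → ℝ) (f g : Finset ι → ℝ) :
    expect p (fun ω => f ω + g ω) = expect p f + expect p g := by
  simp [expect, mul_add, sum_add_distrib]

lemma expect_const_mul (p : ι → ℝ) (c : ℝ) (f : Finset ι → ℝ) :
    expect p (fun ω => c * f ω) = c * expect p f := by
  simp only [expect, mul_sum]
  exact sum_congr rfl fun ω _ => by ring

lemma expect_sum (p : ι → ℝ) {κ : Type*} (I : Finset κ) (f : κ → Finset ι → ℝ) :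
    expect p (fun ω => ∑ i ∈ I, f i ω) = ∑ i ∈ I, expect p (f i) := by
  simp only [expect, mul_sum]
  exact sum_comm

lemma expect_const (p : ι → ℝ) (c : ℝ) : expect p (fun _ => c) = c := by
  have h : ∑ ω : Finset ι, bernoulliWeight p ω = 1 := by
    have := prod_add p (fun e => 1 - p e) (univ : Finset ι)
    simp only [add_sub_cancel, prod_const_one, powerset_univ] at this
    rw [this]
    refine sum_congr rfl fun ω _ => ?_
    rw [bernoulliWeight, prod_ite]
    congr 2 <;> ext <;> simp
  simp only [expect, ← sum_mul, h, one_mul]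

lemma expect_split (p : ι → ℝ) (e : ι) (F : Finset ι → ℝ) :
    expect p F = p e * expect p (fun ω => F (insert e ω))
      + (1 - p e) * expect p (fun ω => F (ω.erase e)) := by
  have key : ∀ G : Finset ι → ℝ, expect p G = ∑ t ∈ (univ.erase e).powerset,
      (∏ x ∈ univ.erase e, if x ∈ t then p x else 1 - p x) *
        ((1 - p e) * G t + p e * G (insert e t)) := by
    intro G
    have hu : (univ : Finset (Finset ι)) = (insert e (univ.erase e)).powerset := by
      rw [insert_erase (mem_univ e), powerset_univ]
    rw [expect, hu, sum_powerset_insert (notMem_erase e univ), ← sum_add_distrib]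
    refine sum_congr rfl fun t ht => ?_
    have het : e ∉ t := fun h => notMem_erase e univ (mem_powerset.1 ht h)
    rw [bernoulliWeight, bernoulliWeight, ← mul_prod_erase univ _ (mem_univ e),
      ← mul_prod_erase univ _ (mem_univ e)]
    simp only [het, if_false, mem_insert_self, if_true]
    have h2 : ∏ x ∈ univ.erase e, (if x ∈ insert e t then p x else 1 - p x)
        = ∏ x ∈ univ.erase e, (if x ∈ t then p x else 1 - p x) := by
      refine prod_congr rfl fun x hx => ?_
      simp [mem_insert, (mem_erase.1 hx).1]
    rw [h2]
    ring
  rw [key F, key, key, mul_sum, mul_sum, ← sum_add_distrib]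
  refine sum_congr rfl fun t ht => ?_
  have het : e ∉ t := fun h => notMem_erase e univ (mem_powerset.1 ht h)
  simp only [insert_idem, erase_insert het, erase_eq_of_notMem het]
  ring

lemma expect_subset_mul (p : ι → ℝ) (A : Finset ι) (g : Finset ι → ℝ) :
    expect p (fun ω => if A ⊆ ω then g ω else 0)
      = (∏ e ∈ A, p e) * expect p (fun ω => g (ω ∪ A)) := by
  induction A using Finset.induction_on generalizing g with
  | empty => simp
  | insert e A he ih =>
    rw [expect_split p e]
    have h1 : ∀ ω : Finset ι, (if insert e A ⊆ insert e ω then g (insert e ω) else 0)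
        = if A ⊆ ω then g (insert e ω) else 0 := by
      intro ω
      have : insert e A ⊆ insert e ω ↔ A ⊆ ω := by
        rw [insert_subset_insert_iff he]
      simp [this]
    have h2 : ∀ ω : Finset ι, (if insert e A ⊆ ω.erase e then g (ω.erase e) else 0) = 0 := by
      intro ω
      rw [if_neg]
      intro h
      exact notMem_erase e ω (h (mem_insert_self e A))
    simp only [h1, h2]
    rw [ih (fun ω => g (insert e ω)), expect_const, prod_insert he]
    have h3 : ∀ ω : Finset ι, insert e (ω ∪ A) = ω ∪ insert e A := fun ω =>
      (union_insert e ω A).symm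
    simp only [h3]
    ring

lemma expect_mul_of_disjoint (p : ι → ℝ) (R : Finset ι) (f g : Finset ι → ℝ) :
    expect p (fun ω => f (ω ∩ R) * g (ω \ R))
      = expect p (fun ω => f (ω ∩ R)) * expect p (fun ω => g (ω \ R)) := by
  induction R using Finset.induction_on generalizing f g with
  | empty => simp [expect_const, expect_const_mul]
  | insert e R he ih =>
    have hi : ∀ ω : Finset ι, insert e ω ∩ insert e R = insert e (ω ∩ R) := fun ω =>
      (insert_inter_distrib ω R e).symm
    have hd : ∀ ω : Finset ι, insert e ω \ insert e R = (ω \ R).erase e := by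
      intro ω; ext x; simp only [mem_sdiff, mem_insert, mem_erase]; tauto
    have hi' : ∀ ω : Finset ι, ω.erase e ∩ insert e R = ω ∩ R := by
      intro ω; ext x
      simp only [mem_inter, mem_insert, mem_erase]
      constructor
      · rintro ⟨⟨h1, h2⟩, h3 | h3⟩
        · exact absurd h3 h1
        · exact ⟨h2, h3⟩
      · rintro ⟨h1, h2⟩
        exact ⟨⟨fun h => he (h ▸ h2), h1⟩, Or.inr h2⟩
    have hd' : ∀ ω : Finset ι, ω.erase e \ insert e R = (ω \ R).erase e := by
      intro ω; ext x; simp only [mem_sdiff, mem_insert, mem_erase]; tauto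
    rw [expect_split p e, expect_split p e (fun ω => f (ω ∩ insert e R)),
      expect_split p e (fun ω => g (ω \ insert e R))]
    simp only [hi, hd, hi', hd']
    rw [ih (fun ω => f (insert e ω)) (fun ω => g (ω.erase e)), ih f (fun ω => g (ω.erase e))]
    ring

/-- An upper bound on the Laplace transform of the number of sets `A i` contained in a random
set (Janson's inequality). -/
lemma expect_exp_neg_le {κ : Type*} [DecidableEq κ] {p : ι → ℝ} (h0 : ∀ e, 0 ≤ p e)
    (h1 : ∀ e, p e ≤ 1) (I : Finset κ) (A : κ → Finset ι) (t : ℝ) (ht : 0 ≤ t) :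
    expect p (fun ω => Real.exp (-t * ∑ i ∈ I, if A i ⊆ ω then (1 : ℝ) else 0))
      ≤ Real.exp (-t * (∑ i ∈ I, ∏ e ∈ A i, p e) + t ^ 2 / 2 *
        ∑ i ∈ I, ∑ j ∈ I with ¬ Disjoint (A i) (A j), ∏ e ∈ A i ∪ A j, p e) := by
  set X : Finset ι → ℝ := fun ω => ∑ i ∈ I, if A i ⊆ ω then (1 : ℝ) else 0 with hX
  set μ := ∑ i ∈ I, ∏ e ∈ A i, p e with hμ
  set Δ := ∑ i ∈ I, ∑ j ∈ I with ¬ Disjoint (A i) (A j), ∏ e ∈ A i ∪ A j, p e with hΔ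
  set ψ : ℝ → ℝ := fun t => expect p (fun ω => Real.exp (-t * X ω)) with hψ
  have hψpos : ∀ t, 0 ≤ ψ t := fun t => expect_nonneg h0 h1 fun ω => (Real.exp_pos _).le
  have hderiv : ∀ t, HasDerivAt ψ (-expect p (fun ω => X ω * Real.exp (-t * X ω))) t := by
    intro t
    have : ∀ ω ∈ (univ : Finset (Finset ι)), HasDerivAt
        (fun t => bernoulliWeight p ω * Real.exp (-t * X ω))
        (bernoulliWeight p ω * (Real.exp (-t * X ω) * (-1 * X ω))) t := by
      intro ω _
      exact (((hasDerivAt_id t).neg.mul_const (X ω)).exp).const_mul _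
    have h := HasDerivAt.fun_sum this
    refine h.congr_deriv ?_
    simp only [expect]
    rw [← sum_neg_distrib]
    exact sum_congr rfl fun ω _ => by ring
  have hmain : ∀ t, 0 ≤ t →
      (μ - t * Δ) * ψ t ≤ expect p (fun ω => X ω * Real.exp (-t * X ω)) := by
    intro t ht
    have hsum : expect p (fun ω => X ω * Real.exp (-t * X ω))
        = ∑ i ∈ I, expect p (fun ω => if A i ⊆ ω then Real.exp (-t * X ω) else 0) := by
      rw [← expect_sum]
      congr 1
      funext ω
      rw [hX]
      simp only [sum_mul]
      exact sum_congr rfl fun i _ => by split_ifs <;> simp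
    rw [hsum, hμ, hΔ, mul_sum, ← sum_sub_distrib, sum_mul]
    refine sum_le_sum fun i hi => ?_
    set π := ∏ e ∈ A i, p e with hπ
    set Δi := ∑ j ∈ I with ¬ Disjoint (A i) (A j), ∏ e ∈ A i ∪ A j, p e with hΔi
    rcases le_or_gt (π - t * Δi) 0 with hneg | hpos
    · refine le_trans (mul_nonpos_of_nonpos_of_nonneg hneg (hψpos t)) ?_
      refine expect_nonneg h0 h1 fun ω => ?_
      split_ifs
      · exact (Real.exp_pos _).le
      · exact le_rfl
    set X₁ : Finset ι → ℝ :=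
      fun ω => ∑ j ∈ I with ¬ Disjoint (A i) (A j), if A j ⊆ ω then (1 : ℝ) else 0 with hX₁
    set X₂ : Finset ι → ℝ :=
      fun ω => ∑ j ∈ I with Disjoint (A i) (A j), if A j ⊆ ω then (1 : ℝ) else 0 with hX₂
    have hX12 : ∀ ω, X ω = X₂ ω + X₁ ω := fun ω =>
      (sum_filter_add_sum_filter_not I (fun j => Disjoint (A i) (A j)) _).symm
    have hX₁nn : ∀ ω, 0 ≤ X₁ ω := fun ω => sum_nonneg fun j _ => by split_ifs <;> norm_num
    set ψ₂ := expect p (fun ω => Real.exp (-t * X₂ ω)) with hψ₂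
    have hψ₂le : ψ t ≤ ψ₂ := by
      refine expect_mono h0 h1 fun ω => Real.exp_le_exp.2 ?_
      rw [hX12 ω]
      nlinarith [mul_nonneg ht (hX₁nn ω)]
    have hind : expect p (fun ω => if A i ⊆ ω then Real.exp (-t * X₂ ω) else 0) = π * ψ₂ := by
      rw [expect_subset_mul]
      congr 2
      funext ω
      congr 2
      refine sum_congr rfl fun j hj => ?_
      have hd := (mem_filter.1 hj).2
      have : A j ⊆ ω ∪ A i ↔ A j ⊆ ω := by
        constructor
        · intro h x hx
          rcases mem_union.1 (h hx) with h' | h'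
          · exact h'
          · exact absurd hx (Finset.disjoint_left.1 hd h')
        · exact fun h => h.trans subset_union_left
      simp [this]
    have hcorr : expect p (fun ω => if A i ⊆ ω then X₁ ω * Real.exp (-t * X₂ ω) else 0)
        ≤ Δi * ψ₂ := by
      have : ∀ ω, (if A i ⊆ ω then X₁ ω * Real.exp (-t * X₂ ω) else 0)
          = ∑ j ∈ I with ¬ Disjoint (A i) (A j),
            if A i ∪ A j ⊆ ω then Real.exp (-t * X₂ ω) else 0 := by
        intro ω
        rw [hX₁]
        by_cases h : A i ⊆ ω
        · simp only [h, if_true, sum_mul, union_subset_iff, true_and]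
          exact sum_congr rfl fun j _ => by split_ifs <;> simp
        · simp [h, union_subset_iff]
      simp only [this]
      rw [expect_sum, hΔi, sum_mul]
      refine sum_le_sum fun j _ => ?_
      rw [expect_subset_mul]
      refine mul_le_mul_of_nonneg_left ?_ (prod_nonneg fun e _ => h0 e)
      refine expect_mono h0 h1 fun ω => Real.exp_le_exp.2 ?_
      have : X₂ ω ≤ X₂ (ω ∪ (A i ∪ A j)) := by
        refine sum_le_sum fun k _ => ?_
        by_cases hk : A k ⊆ ω
        · simp [hk, hk.trans subset_union_left]
        · simp only [hk, if_false]; split_ifs <;> norm_num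
      nlinarith
    calc (π - t * Δi) * ψ t ≤ (π - t * Δi) * ψ₂ := mul_le_mul_of_nonneg_left hψ₂le hpos.le
      _ ≤ expect p (fun ω => if A i ⊆ ω then Real.exp (-t * X₂ ω) else 0)
          + -t * expect p (fun ω => if A i ⊆ ω then X₁ ω * Real.exp (-t * X₂ ω) else 0) := by
        rw [hind]
        nlinarith [mul_le_mul_of_nonneg_left hcorr ht]
      _ ≤ _ := by
        rw [← expect_const_mul, ← expect_add]
        refine expect_mono h0 h1 fun ω => ?_
        split_ifs
        · have h3 : Real.exp (-t * X ω) = Real.exp (-t * X₁ ω) * Real.exp (-t * X₂ ω) := by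
            rw [← Real.exp_add, hX12]
            ring_nf
          have h4 := Real.add_one_le_exp (-t * X₁ ω)
          rw [h3]
          nlinarith [mul_le_mul_of_nonneg_right h4 (Real.exp_pos (-t * X₂ ω)).le]
        · simp
  set φ : ℝ → ℝ := fun t => ψ t * Real.exp (t * μ - t ^ 2 / 2 * Δ) with hφ
  have hφd : ∀ t, HasDerivAt φ (-expect p (fun ω => X ω * Real.exp (-t * X ω)) *
      Real.exp (t * μ - t ^ 2 / 2 * Δ) +
      ψ t * (Real.exp (t * μ - t ^ 2 / 2 * Δ) * (μ - t * Δ))) t := by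
    intro t
    refine (hderiv t).mul ?_
    have h2 : HasDerivAt (fun t : ℝ => t * μ - t ^ 2 / 2 * Δ) (μ - t * Δ) t := by
      have ha := (hasDerivAt_id t).mul_const μ
      have hb := ((hasDerivAt_pow 2 t).div_const 2).mul_const Δ
      refine (ha.sub hb).congr_deriv ?_
      norm_num
    exact h2.exp
  have hanti : AntitoneOn φ (Set.Ici 0) := by
    refine antitoneOn_of_deriv_nonpos (convex_Ici 0)
      (fun x _ => (hφd x).continuousAt.continuousWithinAt)
      (fun x _ => (hφd x).differentiableAt.differentiableWithinAt) fun x hx => ?_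
    rw [interior_Ici] at hx
    rw [(hφd x).deriv]
    have := hmain x (le_of_lt hx)
    nlinarith [mul_le_mul_of_nonneg_right this (Real.exp_pos (x * μ - x ^ 2 / 2 * Δ)).le]
  have h01 : φ t ≤ 1 := by
    have := hanti (Set.mem_Ici.2 le_rfl) (Set.mem_Ici.2 ht) ht
    refine this.trans (le_of_eq ?_)
    simp [hφ, hψ, expect_const]
  have hexp : Real.exp (-t * μ + t ^ 2 / 2 * Δ) * Real.exp (t * μ - t ^ 2 / 2 * Δ) = 1 := by
    rw [← Real.exp_add]
    ring_nf
    exact Real.exp_zero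
  have hE := Real.exp_pos (t * μ - t ^ 2 / 2 * Δ)
  rw [← hexp] at h01
  exact le_of_mul_le_mul_right h01 hE

/-- The lower tail form of Janson's inequality. -/
lemma janson_lower_tail {κ : Type*} [DecidableEq κ] {p : ι → ℝ} (h0 : ∀ e, 0 ≤ p e)
    (h1 : ∀ e, p e ≤ 1) (I : Finset κ) (A : κ → Finset ι) {a Δ : ℝ} (ha : 0 ≤ a) (hΔ : 0 < Δ)
    (hle : ∑ i ∈ I, ∑ j ∈ I with ¬ Disjoint (A i) (A j), ∏ e ∈ A i ∪ A j, p e ≤ Δ) :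
    expect p (fun ω => if (∑ i ∈ I, if A i ⊆ ω then (1 : ℝ) else 0)
      ≤ (∑ i ∈ I, ∏ e ∈ A i, p e) - a then 1 else 0) ≤ Real.exp (-(a ^ 2 / (2 * Δ))) := by
  set μ := ∑ i ∈ I, ∏ e ∈ A i, p e with hμ
  set t := a / Δ with ht
  have ht0 : 0 ≤ t := div_nonneg ha hΔ.le
  calc _ ≤ expect p (fun ω => Real.exp (t * (μ - a)) *
          Real.exp (-t * ∑ i ∈ I, if A i ⊆ ω then (1 : ℝ) else 0)) := by
        refine expect_mono h0 h1 fun ω => ?_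
        rw [← Real.exp_add]
        split_ifs with h
        · rw [Real.one_le_exp_iff]
          nlinarith [mul_le_mul_of_nonneg_left h ht0]
        · exact (Real.exp_pos _).le
    _ = Real.exp (t * (μ - a)) *
          expect p (fun ω => Real.exp (-t * ∑ i ∈ I, if A i ⊆ ω then (1 : ℝ) else 0)) :=
        expect_const_mul _ _ _
    _ ≤ Real.exp (t * (μ - a)) * Real.exp (-t * μ + t ^ 2 / 2 * Δ) := by
        refine mul_le_mul_of_nonneg_left ?_ (Real.exp_pos _).le
        refine (expect_exp_neg_le h0 h1 I A t ht0).trans (Real.exp_le_exp.2 ?_)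
        have := mul_le_mul_of_nonneg_left hle (by positivity : 0 ≤ t ^ 2 / 2)
        linarith
    _ = Real.exp (-(a ^ 2 / (2 * Δ))) := by
        rw [← Real.exp_add]
        congr 1
        rw [ht]
        field_simp
        ring

end ProductMeasure

section WalkSum

open Finset

variable {V : Type*} {r : ℕ}

/-- The first endpoints of the edges `(u₀, v₀), (u₁, v₁), …, (u_r, z)`, where the consecutive
pairs `(v_i, u_{i+1})` are listed by `mid`. -/
def srcSeq (u₀ : V) (mid : Fin r → V × V) : Fin (r + 1) → V :=
  Fin.cons (α := fun _ => V) u₀ (fun i => (mid i).2)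

/-- The second endpoints of the edges `(u₀, v₀), (u₁, v₁), …, (u_r, z)`, where the consecutive
pairs `(v_i, u_{i+1})` are listed by `mid`. -/
def tgtSeq (mid : Fin r → V × V) (z : V) : Fin (r + 1) → V :=
  Fin.snoc (α := fun _ => V) (fun i => (mid i).1) z

variable [Fintype V]

/-- The total weight of alternating walks with `r + 1` steps weighted by `W` separated by `r` steps
weighted by `A`, with initial weight `a` and final weight `b`. -/
def walkSum (W A : V → V → ℝ) (b : V → ℝ) (r : ℕ) (a : V → ℝ) : ℝ :=
  ∑ u₀, ∑ mid : Fin r → V × V, ∑ z, a u₀ * (∏ i, A (mid i).1 (mid i).2) *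
    (∏ i, W (srcSeq u₀ mid i) (tgtSeq mid z i)) * b z

/-- The effect of a step weighted by `W` followed by a step weighted by `A`. -/
def walkStep (W A : V → V → ℝ) (a : V → ℝ) (u : V) : ℝ := ∑ u₀, ∑ v, a u₀ * W u₀ v * A v u

lemma walkSum_zero (W A : V → V → ℝ) (b a : V → ℝ) :
    walkSum W A b 0 a = ∑ u₀, ∑ z, a u₀ * W u₀ z * b z := by
  simp [walkSum, srcSeq, tgtSeq, Fin.snoc]

lemma walkSum_succ (W A : V → V → ℝ) (b : V → ℝ) (r : ℕ) (a : V → ℝ) :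
    walkSum W A b (r + 1) a = walkSum W A b r (walkStep W A a) := by
  have h1 : ∀ u₀ : V, ∑ mid : Fin (r + 1) → V × V, ∑ z, a u₀ * (∏ i, A (mid i).1 (mid i).2) *
      (∏ i, W (srcSeq u₀ mid i) (tgtSeq mid z i)) * b z
      = ∑ v, ∑ u, a u₀ * W u₀ v * A v u * ∑ mid : Fin r → V × V, ∑ z,
        (∏ i, A (mid i).1 (mid i).2) *
        (∏ i, W (srcSeq u mid i) (tgtSeq mid z i)) * b z := by
    intro u₀
    rw [← (Fin.consEquiv (fun _ : Fin (r + 1) => V × V)).sum_comp, Fintype.sum_prod_type,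
      Fintype.sum_prod_type]
    refine sum_congr rfl fun v _ => sum_congr rfl fun u _ => ?_
    rw [mul_sum]
    refine sum_congr rfl fun mid _ => ?_
    rw [mul_sum]
    refine sum_congr rfl fun z _ => ?_
    have hs : srcSeq u₀ (Fin.cons (α := fun _ => V × V) (v, u) mid)
        = Fin.cons (α := fun _ => V) u₀ (srcSeq u mid) := by
      unfold srcSeq
      congr 1
      funext i
      refine Fin.cases ?_ (fun j => ?_) i <;> simp
    have ht : tgtSeq (Fin.cons (α := fun _ => V × V) (v, u) mid) z
        = Fin.cons (α := fun _ => V) v (tgtSeq mid z) := by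
      unfold tgtSeq
      rw [Fin.cons_snoc_eq_snoc_cons]
      congr 1
      funext i
      refine Fin.cases ?_ (fun j => ?_) i <;> simp
    have hc : (Fin.consEquiv (fun _ : Fin (r + 1) => V × V)) ((v, u), mid)
        = Fin.cons (α := fun _ => V × V) (v, u) mid := rfl
    rw [hc, hs, ht, Fin.prod_univ_succ, Fin.prod_univ_succ (n := r + 1)]
    simp only [Fin.cons_zero, Fin.cons_succ]
    ring
  unfold walkSum
  simp only [h1]
  have h2 : ∀ u, ∑ mid : Fin r → V × V, ∑ z, walkStep W A a u * (∏ i, A (mid i).1 (mid i).2) *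
      (∏ i, W (srcSeq u mid i) (tgtSeq mid z i)) * b z
      = ∑ u₀, ∑ v, a u₀ * W u₀ v * A v u * ∑ mid : Fin r → V × V, ∑ z,
        (∏ i, A (mid i).1 (mid i).2) *
        (∏ i, W (srcSeq u mid i) (tgtSeq mid z i)) * b z := by
    intro u
    have h3 : ∀ c : ℝ, ∑ mid : Fin r → V × V, ∑ z, c * (∏ i, A (mid i).1 (mid i).2) *
        (∏ i, W (srcSeq u mid i) (tgtSeq mid z i)) * b z
        = c * ∑ mid : Fin r → V × V, ∑ z, (∏ i, A (mid i).1 (mid i).2) *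
          (∏ i, W (srcSeq u mid i) (tgtSeq mid z i)) * b z := by
      intro c
      simp only [mul_sum, mul_assoc]
    rw [h3, walkStep, sum_mul]
    simp only [sum_mul]
  simp only [h2]
  rw [sum_comm]
  conv_rhs => rw [sum_comm]
  rw [sum_comm]
  refine sum_congr rfl fun u₀ _ => ?_
  rw [sum_comm]

lemma walkSum_eq_iterate (W A : V → V → ℝ) (b : V → ℝ) (r : ℕ) (a : V → ℝ) :
    walkSum W A b r a = walkSum W A b 0 ((walkStep W A)^[r] a) := by
  induction r generalizing a with
  | zero => rfl
  | succ r ih => rw [walkSum_succ, ih, Function.iterate_succ_apply]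

lemma walkSum_const {A : V → V → ℝ} {d : ℝ} (hd : ∀ v, ∑ u, A v u = d) (p : ℝ) (b : V → ℝ)
    (r : ℕ) (a : V → ℝ) :
    walkSum (fun _ _ => p) A b r a
      = p * (∑ z, b z) * (((Fintype.card V : ℝ) * d * p) ^ r * ∑ u, a u) := by
  have hstep : ∀ a : V → ℝ, ∑ u, walkStep (fun _ _ => p) A a u
      = (Fintype.card V : ℝ) * d * p * ∑ u, a u := by
    intro a
    unfold walkStep
    rw [sum_comm, mul_sum]
    refine sum_congr rfl fun u₀ _ => ?_
    rw [sum_comm]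
    simp only [← mul_sum, hd, sum_const, card_univ, nsmul_eq_mul]
    ring
  induction r generalizing a with
  | zero =>
    rw [walkSum_zero, mul_assoc, pow_zero, one_mul, mul_comm (∑ z, b z), sum_mul_sum, mul_sum]
    refine sum_congr rfl fun u _ => ?_
    rw [mul_sum]
    exact sum_congr rfl fun z _ => by ring
  | succ r ih => rw [walkSum_succ, ih, hstep]; ring

/-- If `W` is `p` plus the indicator of the pairs `(src j, tgt j)`, then the walk sum is bounded
by means of the total mass of the iterated weights and their mass on the vertices `src j`. -/
lemma walkSum_le_of_perturbation {J : Type*} [Fintype J] [DecidableEq V] {A : V → V → ℝ} {d : ℝ}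
    (hA0 : ∀ v u, 0 ≤ A v u) (hA1 : ∀ v u, A v u ≤ 1) (hrow : ∀ v, ∑ u, A v u = d)
    (hcol : ∀ u, ∑ v, A v u = d) {p : ℝ} (hp : 0 ≤ p) (src tgt : J → V) {b : V → ℝ}
    (hb : ∀ v, 0 ≤ b v) (hbd : ∑ v, b v = d) (hb2 : ∑ j, b (tgt j) ≤ 2)
    {a : V → ℝ} (ha : ∀ v, 0 ≤ a v) (k : ℕ) :
    ∃ σ β : ℕ → ℝ, σ 0 = ∑ v, a v ∧ β 0 = ∑ j, a (src j) ∧ (∀ i, 0 ≤ σ i) ∧ (∀ i, 0 ≤ β i) ∧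
      (∀ i, σ (i + 1) = (Fintype.card V : ℝ) * d * p * σ i + d * β i) ∧
      (∀ i, β (i + 1) ≤ Fintype.card J * (p * d * σ i + β i)) ∧
      walkSum (fun u v => p + ∑ j, if src j = u ∧ tgt j = v then (1 : ℝ) else 0) A b (k + 1) a
        ≤ p * d * σ (k + 1) + 2 * (p * d * σ k + β k) := by
  set W : V → V → ℝ := fun u v => p + ∑ j, if src j = u ∧ tgt j = v then (1 : ℝ) else 0 with hW
  have hsum : ∀ (a f : V → ℝ), ∑ u, ∑ v, a u * W u v * f v
      = p * (∑ u, a u) * (∑ v, f v) + ∑ j, a (src j) * f (tgt j) := by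
    intro a f
    have h1 : ∀ u v, a u * W u v * f v
        = p * (a u * f v) + ∑ j, if src j = u ∧ tgt j = v then a u * f v else 0 := by
      intro u v
      rw [hW]
      simp only [mul_add, add_mul, mul_sum, sum_mul, mul_ite, ite_mul, mul_one, mul_zero, zero_mul]
      ring
    simp only [h1, sum_add_distrib, ← mul_sum]
    congr 1
    · rw [mul_assoc, sum_mul]
    · have h2 : ∀ u, ∑ v, ∑ j, (if src j = u ∧ tgt j = v then a u * f v else 0)
          = ∑ j, if src j = u then a u * f (tgt j) else 0 := by
        intro u
        rw [sum_comm]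
        refine sum_congr rfl fun j _ => ?_
        by_cases h : src j = u <;> simp [h]
      simp only [h2]
      rw [sum_comm]
      exact sum_congr rfl fun j _ => by simp
  have hW0 : ∀ u v, 0 ≤ W u v := fun u v =>
    add_nonneg hp (sum_nonneg fun j _ => by split_ifs <;> norm_num)
  have hstep0 : ∀ a : V → ℝ, (∀ v, 0 ≤ a v) → ∀ u, 0 ≤ walkStep W A a u := fun a ha u =>
    sum_nonneg fun u₀ _ => sum_nonneg fun v _ =>
      mul_nonneg (mul_nonneg (ha u₀) (hW0 u₀ v)) (hA0 v u)
  have hval : ∀ (a : V → ℝ) u, walkStep W A a u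
      = p * (∑ v, a v) * d + ∑ j, a (src j) * A (tgt j) u := by
    intro a u
    unfold walkStep
    rw [hsum a (fun v => A v u), hcol]
  have hle : ∀ a : V → ℝ, (∀ v, 0 ≤ a v) → ∀ u,
      walkStep W A a u ≤ p * d * (∑ v, a v) + ∑ j, a (src j) := by
    intro a ha u
    rw [hval]
    have : ∑ j, a (src j) * A (tgt j) u ≤ ∑ j, a (src j) :=
      sum_le_sum fun j _ => mul_le_of_le_one_right (ha _) (hA1 _ _)
    linarith
  set seq : ℕ → V → ℝ := fun i => (walkStep W A)^[i] a with hseq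
  have hsucc : ∀ i, seq (i + 1) = walkStep W A (seq i) := fun i =>
    Function.iterate_succ_apply' _ _ _
  have hseq0 : ∀ i v, 0 ≤ seq i v := by
    intro i
    induction i with
    | zero => exact ha
    | succ i ih => rw [hsucc]; exact hstep0 _ ih
  refine ⟨fun i => ∑ v, seq i v, fun i => ∑ j, seq i (src j), rfl, rfl,
    fun i => sum_nonneg fun v _ => hseq0 i v, fun i => sum_nonneg fun j _ => hseq0 i _,
    fun i => ?_, fun i => ?_, ?_⟩
  · simp only [hsucc, hval, sum_add_distrib, sum_const, card_univ, nsmul_eq_mul]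
    rw [sum_comm]
    simp only [← mul_sum, hrow, ← sum_mul]
    ring
  · simp only [hsucc]
    calc ∑ j, walkStep W A (seq i) (src j)
        ≤ ∑ _j : J, (p * d * (∑ v, seq i v) + ∑ j, seq i (src j)) :=
          sum_le_sum fun j _ => hle _ (hseq0 i) _
      _ = _ := by simp only [sum_const, card_univ, nsmul_eq_mul]
  · rw [walkSum_eq_iterate, walkSum_zero]
    change ∑ u₀, ∑ z, seq (k + 1) u₀ * W u₀ z * b z ≤ _
    rw [hsum, hbd]
    have h1 : ∑ j, seq (k + 1) (src j) * b (tgt j)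
        ≤ ∑ j, (p * d * (∑ v, seq k v) + ∑ j, seq k (src j)) * b (tgt j) := by
      refine sum_le_sum fun j _ => mul_le_mul_of_nonneg_right ?_ (hb _)
      rw [hsucc]
      exact hle _ (hseq0 k) _
    rw [← mul_sum] at h1
    have hd : 0 ≤ d := hbd ▸ sum_nonneg fun v _ => hb v
    have h2 : 0 ≤ p * d * (∑ v, seq k v) + ∑ j, seq k (src j) :=
      add_nonneg (mul_nonneg (mul_nonneg hp hd) (sum_nonneg fun v _ => hseq0 k v))
        (sum_nonneg fun j _ => hseq0 k _)
    have h3 := mul_le_mul_of_nonneg_left hb2 h2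
    linarith

/-- A growth estimate for the recursion satisfied by perturbed walk sums. -/
lemma perturbed_growth_bound {σ β : ℕ → ℝ} {d s q D L N : ℝ} {k : ℕ} (hd : 0 < d) (hs : 1 ≤ s)
    (hD : 1 ≤ D) (hL : 0 ≤ L) (hN : 0 < N) (hq : q = D / N)
    (hβn : ∀ i, 0 ≤ β i)
    (hσ0 : σ 0 = d * s) (hβ0 : β 0 ≤ 2 * d)
    (hσ : ∀ i, σ (i + 1) = D * σ i + d * β i) (hβ : ∀ i, β (i + 1) ≤ L * (q * σ i + β i))
    (hLD : 2 * L ≤ D) (hNL : N * L ^ k ≤ D ^ k) (hkN : 4 * (k + 1) * d * L ≤ N)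
    (hDs : 4 * d ≤ D * s) :
    q * σ (k + 1) + 2 * (q * σ k + β k)
      ≤ q * (d * s) * D ^ (k + 1) * (1 + (21 / D + 8 * d / (D * s))) := by
  have hD0 : 0 < D := by linarith
  have hs0 : 0 < s := by linarith
  have hq0 : 0 < q := hq ▸ div_pos hD0 hN
  set τ := 2 * d * L / (N * D) with hτ
  have hτ0 : 0 ≤ τ := by positivity
  have hΦ : ∀ i, σ i + 2 * d / D * β i ≤ (D * (1 + τ)) ^ i * (d * s + 4 * d ^ 2 / D) := by
    intro i
    induction i with
    | zero =>
      have : 2 * d / D * β 0 ≤ 2 * d / D * (2 * d) := mul_le_mul_of_nonneg_left hβ0 (by positivity)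
      have h2 : 2 * d / D * (2 * d) = 4 * d ^ 2 / D := by ring
      simp only [pow_zero, one_mul]
      linarith
    | succ i ih =>
      have h1 : 2 * d / D * β (i + 1) ≤ 2 * d / D * (L * (q * σ i + β i)) :=
        mul_le_mul_of_nonneg_left (hβ i) (by positivity)
      have h2 : 2 * d / D * (L * (q * σ i + β i)) = D * τ * (1 / D) * D * σ i
          + d * (2 * L / D) * β i := by
        rw [hq, hτ]; field_simp
      have h3 : 2 * L / D ≤ 1 := (div_le_one hD0).2 hLD
      have h4 : d * (2 * L / D) * β i ≤ d * 1 * β i :=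
        mul_le_mul_of_nonneg_right (mul_le_mul_of_nonneg_left h3 hd.le) (hβn i)
      have h5 : D * (1 + τ) * (σ i + 2 * d / D * β i)
          = D * (1 + τ) * σ i + 2 * d * (1 + τ) * β i := by field_simp
      have h6 : D * τ * (1 / D) * D * σ i = D * τ * σ i := by field_simp
      have h7 := mul_le_mul_of_nonneg_left ih (by positivity : 0 ≤ D * (1 + τ))
      have h8 : 0 ≤ d * τ * β i := mul_nonneg (mul_nonneg hd.le hτ0) (hβn i)
      rw [pow_succ, hσ]
      nlinarith
  have hpow : ∀ i, i ≤ k + 1 → (1 + τ) ^ i ≤ 1 + 1 / D := by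
    intro i hi
    have hik : (i : ℝ) ≤ k + 1 := by exact_mod_cast hi
    have hiτ : i * τ ≤ 1 / (2 * D) := by
      rw [hτ, ← mul_div_assoc, div_le_div_iff₀ (by positivity) (by positivity)]
      have : (i : ℝ) * (2 * d * L) ≤ (k + 1) * (2 * d * L) :=
        mul_le_mul_of_nonneg_right hik (by positivity)
      nlinarith
    have hh : 1 / (2 * D) ≤ 1 / 2 := by
      rw [div_le_div_iff₀ (by positivity) (by positivity)]; linarith
    have h1 : (1 + τ) ^ i ≤ Real.exp (i * τ) := by
      rw [mul_comm, Real.exp_mul, Real.rpow_natCast]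
      exact pow_le_pow_left₀ (by positivity) (by linarith [Real.add_one_le_exp τ]) i
    have h2 : Real.exp (i * τ) * (1 - i * τ) ≤ 1 := by
      have := Real.add_one_le_exp (-(i * τ))
      have h3 : Real.exp (i * τ) * Real.exp (-(i * τ)) = 1 := by
        rw [← Real.exp_add]; simp
      nlinarith [Real.exp_pos (i * τ)]
    have h0 : 0 ≤ i * τ := by positivity
    have h4 : 1 / D = 2 * (1 / (2 * D)) := by field_simp
    have h5 : Real.exp (i * τ) ≤ 1 + 2 * (i * τ) := by
      have : (1 : ℝ) ≤ (1 + 2 * (i * τ)) * (1 - i * τ) := by nlinarith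
      have h6 : 0 < 1 - i * τ := by linarith
      exact le_of_mul_le_mul_right (h2.trans this) h6
    linarith
  set η := 4 * d / (D * s) with hη
  have hη0 : 0 ≤ η := by positivity
  have hη1 : η ≤ 1 := (div_le_one (by positivity)).2 hDs
  have hinv : 1 / D ≤ 1 := (div_le_one hD0).2 hD
  have hinv0 : 0 ≤ 1 / D := by positivity
  have hσle : ∀ i, i ≤ k + 1 → σ i ≤ D ^ i * (d * s) * (1 + 1 / D + 2 * η) := by
    intro i hi
    have h1 := hΦ i
    have h2 : 0 ≤ 2 * d / D * β i := mul_nonneg (by positivity) (hβn i)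
    have h3 : d * s + 4 * d ^ 2 / D = d * s * (1 + η) := by rw [hη]; field_simp
    rw [h3, mul_pow] at h1
    calc σ i ≤ D ^ i * (1 + τ) ^ i * (d * s * (1 + η)) := by linarith
      _ ≤ D ^ i * (1 + 1 / D) * (d * s * (1 + η)) := by
        gcongr
        exact hpow i hi
      _ = D ^ i * (d * s) * ((1 + 1 / D) * (1 + η)) := by ring
      _ ≤ _ := by
        gcongr
        nlinarith
  have hσ4 : ∀ i, i ≤ k + 1 → σ i ≤ 4 * (d * s) * D ^ i := by
    intro i hi
    refine (hσle i hi).trans ?_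
    have : 1 + 1 / D + 2 * η ≤ 4 := by linarith
    calc D ^ i * (d * s) * (1 + 1 / D + 2 * η) ≤ D ^ i * (d * s) * 4 := by gcongr
      _ = _ := by ring
  have hβle : ∀ i, i ≤ k → D * β i ≤ 2 * d * D * L ^ i + 8 * L * q * (d * s) * D ^ i := by
    intro i
    induction i with
    | zero =>
      intro _
      have h1 := mul_le_mul_of_nonneg_left hβ0 hD0.le
      have h2 : 0 ≤ 8 * L * q * (d * s) * D ^ 0 := by positivity
      simp only [pow_zero, mul_one] at h2 ⊢
      linarith
    | succ i ih =>
      intro hi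
      have h1 := ih (by omega)
      have h2 := mul_le_mul_of_nonneg_left (hβ i) hD0.le
      have h3 := mul_le_mul_of_nonneg_left (hσ4 i (by omega)) (by positivity : 0 ≤ D * L * q)
      have h4 := mul_le_mul_of_nonneg_left h1 hL
      have h5 : 8 * L * q * (d * s) * D ^ i * L ≤ 8 * L * q * (d * s) * D ^ i * (D / 2) := by
        gcongr
        linarith
      rw [pow_succ, pow_succ]
      nlinarith
  have hMpos : 0 < q * (d * s) * D ^ (k + 1) := by positivity
  have e1 : q * σ (k + 1) ≤ q * (d * s) * D ^ (k + 1) * (1 + 1 / D + 2 * η) := by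
    have := mul_le_mul_of_nonneg_left (hσle (k + 1) le_rfl) hq0.le
    linarith
  have e2 : 2 * (q * σ k) ≤ q * (d * s) * D ^ (k + 1) * (8 / D) := by
    have := mul_le_mul_of_nonneg_left (hσ4 k (by omega)) hq0.le
    have h2 : q * (d * s) * D ^ (k + 1) * (8 / D) = 8 * (q * (d * s) * D ^ k) := by
      rw [pow_succ]; field_simp
    linarith
  have e3 : 2 * β k ≤ q * (d * s) * D ^ (k + 1) * (12 / D) := by
    have h1 := hβle k le_rfl
    have h2 : q * (d * s) * D ^ (k + 1) * (12 / D) = 12 * (q * (d * s) * D ^ k) := by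
      rw [pow_succ]; field_simp
    have h3 : L ^ k ≤ D ^ k * (1 / N) := by
      rw [mul_one_div, le_div_iff₀ hN]; linarith
    have h4 : 2 * d * D * L ^ k ≤ 2 * D * (q * (d * s) * D ^ k) := by
      calc 2 * d * D * L ^ k ≤ 2 * d * D * (D ^ k * (1 / N)) := by gcongr
        _ ≤ 2 * d * D * (D ^ k * (1 / N)) * (D * s) := by
          refine le_mul_of_one_le_right (by positivity) ?_
          nlinarith
        _ = _ := by rw [hq]; field_simp
    have h5 : 8 * L * q * (d * s) * D ^ k ≤ 4 * D * (q * (d * s) * D ^ k) := by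
      have : 8 * L * (q * (d * s) * D ^ k) ≤ 4 * D * (q * (d * s) * D ^ k) := by
        exact mul_le_mul_of_nonneg_right (by linarith) (by positivity)
      linarith
    rw [h2]
    have h6 : D * (2 * β k) ≤ D * (12 * (q * (d * s) * D ^ k)) := by linarith
    exact le_of_mul_le_mul_left h6 hD0
  have e4 : 2 * η = 8 * d / (D * s) := by rw [hη]; ring
  have e5 : q * (d * s) * D ^ (k + 1) * (1 + (21 / D + 8 * d / (D * s)))
      = q * (d * s) * D ^ (k + 1) * (1 + 1 / D + 2 * η)
        + q * (d * s) * D ^ (k + 1) * (8 / D) + q * (d * s) * D ^ (k + 1) * (12 / D) := by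
    rw [e4]; ring
  rw [e5]
  linarith

end WalkSum

section GoodTuples

open Finset

lemma pow_le_card_pairwise {α : Type*} [Fintype α] (D : Finset α) (R : α → α → Prop) (f : ℕ)
    (h : ∀ a ∈ D, #{b ∈ D | ¬ R b a} ≤ f) (r : ℕ) {c : ℝ} (hc0 : 0 ≤ c)
    (hc : c ≤ (#D : ℝ) - r * f) :
    c ^ r ≤ #{m : Fin r → α | (∀ i, m i ∈ D) ∧ ∀ i j, i < j → R (m i) (m j)} := by
  induction r with
  | zero => simp
  | succ r ih =>
    set G : Finset (Fin r → α) := {m | (∀ i, m i ∈ D) ∧ ∀ i j, i < j → R (m i) (m j)} with hG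
    have hc' : c ≤ (#D : ℝ) - r * f := by
      push_cast at hc
      have : (0 : ℝ) ≤ f := Nat.cast_nonneg f
      linarith
    have ih' := ih hc'
    set H : (Fin r → α) → Finset α := fun m => {b ∈ D | ∀ i, R b (m i)} with hH
    have hHcard : ∀ m ∈ G, c ≤ #(H m) := by
      intro m hm
      have hmD := (mem_filter.1 hm).2.1
      have hsub : D ⊆ H m ∪ univ.biUnion (fun i : Fin r => {b ∈ D | ¬ R b (m i)}) := by
        intro b hb
        by_cases hbR : ∀ i, R b (m i)
        · exact mem_union_left _ (mem_filter.2 ⟨hb, hbR⟩)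
        · push Not at hbR
          obtain ⟨i, hi⟩ := hbR
          exact mem_union_right _ (mem_biUnion.2 ⟨i, mem_univ _, mem_filter.2 ⟨hb, hi⟩⟩)
      have h1 : #(univ.biUnion (fun i : Fin r => {b ∈ D | ¬ R b (m i)})) ≤ r * f := by
        have := card_biUnion_le_card_mul (univ : Finset (Fin r))
          (fun i => {b ∈ D | ¬ R b (m i)}) f (fun i _ => h _ (hmD i))
        simpa using this
      have h2 := (card_le_card hsub).trans (card_union_le _ _)
      have h3 : (#D : ℝ) ≤ #(H m) + r * f := by exact_mod_cast h2.trans (by omega)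
      linarith
    have hinj : #(G.sigma H) ≤
        #{m : Fin (r + 1) → α | (∀ i, m i ∈ D) ∧ ∀ i j, i < j → R (m i) (m j)} := by
      refine card_le_card_of_injOn (fun q => Fin.cons (α := fun _ => α) q.2 q.1) ?_ ?_
      · rintro ⟨m, b⟩ hq
        simp only [coe_sigma, Set.mem_sigma_iff, mem_coe] at hq
        obtain ⟨hm, hb⟩ := hq
        have hm' := (mem_filter.1 hm).2
        have hb' := mem_filter.1 hb
        simp only [coe_filter, mem_univ, true_and, Set.mem_ofPred_eq]
        refine ⟨fun i => ?_, fun i j => ?_⟩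
        · refine Fin.cases ?_ (fun i => ?_) i
          · exact hb'.1
          · exact hm'.1 i
        · refine Fin.cases ?_ (fun i => ?_) i <;> refine Fin.cases ?_ (fun j => ?_) j
          · intro h; exact absurd h (lt_irrefl _)
          · intro _; exact hb'.2 j
          · intro h; exact absurd h (Fin.not_lt_zero _)
          · intro h; exact hm'.2 i j (Fin.succ_lt_succ_iff.1 h)
      · rintro ⟨m, b⟩ _ ⟨m', b'⟩ _ heq
        obtain ⟨h1, h2⟩ := Fin.cons_injective2 heq
        subst h1; subst h2; rfl
    have hsig : c ^ r * c ≤ (#(G.sigma H) : ℝ) := by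
      rw [card_sigma]
      push_cast
      calc c ^ r * c ≤ #G * c := mul_le_mul_of_nonneg_right ih' hc0
        _ = ∑ _m ∈ G, c := by simp
        _ ≤ _ := sum_le_sum hHcard
    rw [pow_succ]
    exact hsig.trans (by exact_mod_cast hinj)

variable {V : Type*} [Fintype V] [DecidableEq V] {K : SimpleGraph V} {d r : ℕ}

lemma card_adj_fst_mem (hK : ∀ v, #{u | K.Adj v u} = d) (T : Finset V) :
    #{e : V × V | K.Adj e.1 e.2 ∧ e.1 ∈ T} = d * #T := by
  have : ({e : V × V | K.Adj e.1 e.2 ∧ e.1 ∈ T} : Finset (V × V))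
      = (T.sigma fun v => ({u | K.Adj v u} : Finset V)).map
        (Equiv.sigmaEquivProd V V).toEmbedding := by
    ext ⟨a, b⟩
    simp [and_comm, Equiv.sigmaEquivProd]
  rw [this, card_map, card_sigma]
  simp [hK, mul_comm]

lemma card_adj_snd_mem (hK : ∀ v, #{u | K.Adj v u} = d) (T : Finset V) :
    #{e : V × V | K.Adj e.1 e.2 ∧ e.2 ∈ T} = d * #T := by
  rw [← card_adj_fst_mem hK T]
  refine card_bij (fun e _ => e.swap) ?_ ?_ ?_
  · rintro ⟨a, b⟩ h
    simp only [mem_filter, mem_univ, true_and, Prod.swap] at h ⊢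
    exact ⟨h.1.symm, h.2⟩
  · intro a _ b _ h
    exact Prod.swap_injective h
  · rintro ⟨a, b⟩ h
    simp only [mem_filter, mem_univ, true_and] at h
    exact ⟨(b, a), by simpa using ⟨h.1.symm, h.2⟩, rfl⟩

/-- The vertices that may not be used as internal vertices of a path running from `S` to `y`,
other than its first two and its last internal vertex, which are `s`, `u₀` and `z`. -/
def blocked (K : SimpleGraph V) (S Z : Finset V) (x y s u₀ z : V) : Finset V :=
  Z ∪ {x, y, s, u₀, z} ∪
    (univ.filter (K.Adj y) ∪ (univ.filter (K.Adj u₀) ∪ (univ.filter (K.Adj z) ∪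
      S.biUnion fun t => univ.filter (K.Adj t))))

lemma card_blocked_le (hK : ∀ v, #{u | K.Adj v u} = d) (S Z : Finset V) (x y s u₀ z : V) :
    #(blocked K S Z x y s u₀ z) ≤ #Z + 5 + 3 * d + d * #S := by
  have h5 : #({x, y, s, u₀, z} : Finset V) ≤ 5 := card_le_five
  have hS : #(S.biUnion fun t => univ.filter (K.Adj t)) ≤ #S * d :=
    card_biUnion_le_card_mul S _ d fun t _ => (hK t).le
  unfold blocked
  refine (card_union_le _ _).trans ?_
  have h1 := card_union_le Z {x, y, s, u₀, z}
  have h2 := card_union_le (univ.filter (K.Adj y)) (univ.filter (K.Adj u₀) ∪ (univ.filter (K.Adj z) ∪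
      S.biUnion fun t => univ.filter (K.Adj t)))
  have h3 := card_union_le (univ.filter (K.Adj u₀)) (univ.filter (K.Adj z) ∪
      S.biUnion fun t => univ.filter (K.Adj t))
  have h4 := card_union_le (univ.filter (K.Adj z)) (S.biUnion fun t => univ.filter (K.Adj t))
  rw [hK] at h2 h3 h4
  rw [mul_comm d]
  omega

/-- Two oriented edges of `K` that may occur (in this order) on the same path. -/
def Compatible (K : SimpleGraph V) (e f : V × V) : Prop :=
  e.1 ≠ f.1 ∧ e.2 ≠ f.2 ∧ e.1 ≠ f.2 ∧ e.2 ≠ f.1 ∧ ¬ K.Adj e.2 f.1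

/-- The oriented edges of `K` avoiding the blocked vertices. -/
def freeDarts (K : SimpleGraph V) (S Z : Finset V) (x y s u₀ z : V) : Finset (V × V) :=
  {e | K.Adj e.1 e.2 ∧ e.1 ∉ blocked K S Z x y s u₀ z ∧ e.2 ∉ blocked K S Z x y s u₀ z}

/-- The first two internal vertices `s`, `u₀` of a path, where `z` is its last internal vertex. -/
def startPairs (K : SimpleGraph V) (S Z : Finset V) (x y z : V) : Finset (V × V) :=
  {e | K.Adj e.1 e.2 ∧ e.1 ∈ S ∧ e.1 ≠ z ∧ e.2 ∉ Z ∪ {x, y, z}}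

/-- The last internal vertices of a path ending in `y`. -/
def endVertices (K : SimpleGraph V) (Z : Finset V) (x y : V) : Finset V :=
  {z | K.Adj y z ∧ z ∉ Z ∪ {x}}

/-- The admissible lists of the intermediate `K`-edges of a path. -/
def midLists (K : SimpleGraph V) (S Z : Finset V) (x y s u₀ z : V) (r : ℕ) :
    Finset (Fin r → V × V) :=
  {m | (∀ i, m i ∈ freeDarts K S Z x y s u₀ z) ∧ ∀ i j, i < j → Compatible K (m i) (m j)}

/-- A family of tuples `(s, u₀, z, mid)` encoding paths from `x` through `S` to `y`. -/
def goodTuples (K : SimpleGraph V) (S Z : Finset V) (x y : V) (r : ℕ) :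
    Finset (V × V × V × (Fin r → V × V)) :=
  {Q | Q.2.2.1 ∈ endVertices K Z x y ∧ (Q.1, Q.2.1) ∈ startPairs K S Z x y Q.2.2.1 ∧
    Q.2.2.2 ∈ midLists K S Z x y Q.1 Q.2.1 Q.2.2.1 r}

lemma pow_le_card_midLists (hK : ∀ v, #{u | K.Adj v u} = d) (S Z : Finset V) (x y s u₀ z : V)
    (r : ℕ) {c : ℝ} (hc0 : 0 ≤ c)
    (hc : c ≤ (Fintype.card V : ℝ) * d - 2 * d * (#Z + 5 + 3 * d + d * #S)
      - r * (4 * d + d * d)) :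
    c ^ r ≤ #(midLists K S Z x y s u₀ z r) := by
  set B := blocked K S Z x y s u₀ z with hB
  refine (pow_le_card_pairwise (freeDarts K S Z x y s u₀ z) (Compatible K) (4 * d + d * d) ?_ r
    hc0 ?_).trans (le_of_eq ?_)
  · rintro ⟨v', u'⟩ _
    have hsub : ({e ∈ freeDarts K S Z x y s u₀ z | ¬ Compatible K e (v', u')} : Finset (V × V)) ⊆
        ({e : V × V | K.Adj e.1 e.2 ∧ e.1 ∈ ({v', u'} : Finset V)} : Finset (V × V)) ∪
        ({e : V × V | K.Adj e.1 e.2 ∧ e.2 ∈ ({u', v'} ∪ univ.filter (K.Adj v') : Finset V)} :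
          Finset (V × V)) := by
      rintro ⟨v, u⟩ he
      obtain ⟨he₁, he₂⟩ := mem_filter.1 he
      have he₃ := (mem_filter.1 he₁).2.1
      simp only [Compatible] at he₂ he₃
      simp only [mem_union, mem_filter, mem_univ, true_and, mem_insert, mem_singleton]
      have hs := K.adj_comm u v'
      tauto
    refine (card_le_card hsub).trans ((card_union_le _ _).trans ?_)
    rw [card_adj_fst_mem hK, card_adj_snd_mem hK]
    have h1 : #({v', u'} : Finset V) ≤ 2 := card_le_two
    have h2 : #({u', v'} ∪ univ.filter (K.Adj v') : Finset V) ≤ 2 + d := by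
      refine (card_union_le _ _).trans ?_
      rw [hK]
      have : #({u', v'} : Finset V) ≤ 2 := card_le_two
      omega
    calc d * _ + d * _ ≤ d * 2 + d * (2 + d) :=
          add_le_add (Nat.mul_le_mul_left _ h1) (Nat.mul_le_mul_left _ h2)
      _ = 4 * d + d * d := by ring
  · have hsub : ({e : V × V | K.Adj e.1 e.2 ∧ e.1 ∈ (univ : Finset V)} : Finset (V × V)) ⊆
        freeDarts K S Z x y s u₀ z ∪
        (({e : V × V | K.Adj e.1 e.2 ∧ e.1 ∈ B} : Finset (V × V)) ∪
          ({e : V × V | K.Adj e.1 e.2 ∧ e.2 ∈ B} : Finset (V × V))) := by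
      rintro ⟨v, u⟩ he
      simp only [mem_filter, mem_univ, true_and, and_true] at he
      simp only [freeDarts, mem_union, mem_filter, mem_univ, true_and, ← hB]
      tauto
    have h1 := (card_le_card hsub).trans ((card_union_le _ _).trans
      (Nat.add_le_add_left (card_union_le _ _) _))
    rw [card_adj_fst_mem hK, card_adj_fst_mem hK, card_adj_snd_mem hK, card_univ] at h1
    have h2 := card_blocked_le hK S Z x y s u₀ z
    have h3 : d * Fintype.card V ≤ #(freeDarts K S Z x y s u₀ z)
        + 2 * (d * (#Z + 5 + 3 * d + d * #S)) := by
      have := Nat.mul_le_mul_left d h2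
      rw [← hB] at this
      omega
    have h4 : (d : ℝ) * Fintype.card V ≤ #(freeDarts K S Z x y s u₀ z)
        + 2 * (d * (#Z + 5 + 3 * d + d * #S)) := by exact_mod_cast h3
    push_cast
    linarith
  · unfold midLists
    congr!

lemma le_card_startPairs (hK : ∀ v, #{u | K.Adj v u} = d) (S Z : Finset V) (x y z : V) :
    ((#S : ℝ) - #Z - 4) * d ≤ #(startPairs K S Z x y z) := by
  have hsub : ({e : V × V | K.Adj e.1 e.2 ∧ e.1 ∈ S} : Finset (V × V)) ⊆
      startPairs K S Z x y z ∪
      (({e : V × V | K.Adj e.1 e.2 ∧ e.1 ∈ ({z} : Finset V)} : Finset (V × V)) ∪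
        ({e : V × V | K.Adj e.1 e.2 ∧ e.2 ∈ Z ∪ {x, y, z}} : Finset (V × V))) := by
    rintro ⟨v, u⟩ he
    simp only [mem_filter, mem_univ, true_and] at he
    simp only [startPairs, mem_union, mem_filter, mem_univ, true_and, mem_singleton]
    tauto
  have h1 := (card_le_card hsub).trans ((card_union_le _ _).trans
    (Nat.add_le_add_left (card_union_le _ _) _))
  rw [card_adj_fst_mem hK, card_adj_fst_mem hK, card_adj_snd_mem hK, card_singleton] at h1
  have h2 : #(Z ∪ {x, y, z}) ≤ #Z + 3 :=
    (card_union_le _ _).trans (Nat.add_le_add_left card_le_three _)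
  have h3 : d * #S ≤ #(startPairs K S Z x y z) + (d + d * (#Z + 3)) := by
    have := Nat.mul_le_mul_left d h2
    omega
  have h4 : (d : ℝ) * #S ≤ #(startPairs K S Z x y z) + (d + d * (#Z + 3)) := by
    exact_mod_cast h3
  linarith

lemma le_card_endVertices (hK : ∀ v, #{u | K.Adj v u} = d) (Z : Finset V) (x y : V) :
    (d : ℝ) - #((Z ∪ {x}) ∩ univ.filter (K.Adj y)) ≤ #(endVertices K Z x y) := by
  have hsub : univ.filter (K.Adj y) ⊆
      endVertices K Z x y ∪ ((Z ∪ {x}) ∩ univ.filter (K.Adj y)) := by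
    intro v hv
    simp only [mem_filter, mem_univ, true_and] at hv
    simp only [endVertices, mem_union, mem_inter, mem_filter, mem_univ, true_and]
    tauto
  have h1 := (card_le_card hsub).trans (card_union_le _ _)
  rw [hK] at h1
  have : (d : ℝ) ≤ #(endVertices K Z x y) + #((Z ∪ {x}) ∩ univ.filter (K.Adj y)) := by
    exact_mod_cast h1
  linarith

lemma le_card_goodTuples (hK : ∀ v, #{u | K.Adj v u} = d) (S Z : Finset V) (x y : V)
    (r : ℕ) {c : ℝ} (hc0 : 0 ≤ c)
    (hc : c ≤ (Fintype.card V : ℝ) * d - 2 * d * (#Z + 5 + 3 * d + d * #S)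
      - r * (4 * d + d * d)) (hS : (#Z : ℝ) + 4 ≤ #S) :
    ((d : ℝ) - #((Z ∪ {x}) ∩ univ.filter (K.Adj y))) * (((#S : ℝ) - #Z - 4) * d) * c ^ r
      ≤ #(goodTuples K S Z x y r) := by
  set G := ((endVertices K Z x y).sigma fun z => startPairs K S Z x y z).sigma
    fun q => midLists K S Z x y q.2.1 q.2.2 q.1 r with hG
  have hinj : #G ≤ #(goodTuples K S Z x y r) := by
    refine card_le_card_of_injOn (fun q => (q.1.2.1, q.1.2.2, q.1.1, q.2)) ?_ ?_
    · rintro ⟨⟨z, s, u⟩, m⟩ hq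
      simp only [hG, coe_sigma, Set.mem_sigma_iff, mem_coe] at hq
      simp only [goodTuples, coe_filter, mem_univ, true_and, Set.mem_ofPred_eq]
      exact ⟨hq.1.1, hq.1.2, hq.2⟩
    · rintro ⟨⟨z, s, u⟩, m⟩ _ ⟨⟨z', s', u'⟩, m'⟩ _ h
      simp only [Prod.mk.injEq] at h
      obtain ⟨rfl, rfl, rfl, rfl⟩ := h
      rfl
  have h1 : (#((endVertices K Z x y).sigma fun z => startPairs K S Z x y z) : ℝ) * c ^ r ≤ #G := by
    have hcard : (#G : ℝ) = ∑ q ∈ (endVertices K Z x y).sigma fun z => startPairs K S Z x y z,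
        (#(midLists K S Z x y q.2.1 q.2.2 q.1 r) : ℝ) := by
      exact_mod_cast card_sigma _ _
    rw [hcard]
    calc _ = ∑ _q ∈ (endVertices K Z x y).sigma fun z => startPairs K S Z x y z, c ^ r := by
          rw [sum_const, nsmul_eq_mul]
      _ ≤ _ := sum_le_sum fun q _ => pow_le_card_midLists hK S Z x y q.2.1 q.2.2 q.1 r hc0 hc
  have h2 : (#(endVertices K Z x y) : ℝ) * (((#S : ℝ) - #Z - 4) * d)
      ≤ #((endVertices K Z x y).sigma fun z => startPairs K S Z x y z) := by
    rw [card_sigma]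
    push_cast
    calc _ = ∑ _z ∈ endVertices K Z x y, (((#S : ℝ) - #Z - 4) * d) := by simp
      _ ≤ _ := sum_le_sum fun z _ => le_card_startPairs hK S Z x y z
  have h3 : (0 : ℝ) ≤ ((#S : ℝ) - #Z - 4) * d :=
    mul_nonneg (by linarith) (Nat.cast_nonneg d)
  calc _ ≤ (#(endVertices K Z x y) : ℝ) * (((#S : ℝ) - #Z - 4) * d) * c ^ r :=
        mul_le_mul_of_nonneg_right
          (mul_le_mul_of_nonneg_right (le_card_endVertices hK Z x y) h3) (pow_nonneg hc0 r)
    _ ≤ _ := mul_le_mul_of_nonneg_right h2 (pow_nonneg hc0 r)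
    _ ≤ #G := h1
    _ ≤ _ := by exact_mod_cast hinj

end GoodTuples

section PathEdges

open Finset

variable {V : Type*} {r : ℕ}

lemma exists_srcSeq_eq (u₀ : V) (mid : Fin r → V × V) (i : Fin (r + 1)) :
    (i = 0 ∧ srcSeq u₀ mid i = u₀) ∨ ∃ j : Fin r, i = j.succ ∧ srcSeq u₀ mid i = (mid j).2 := by
  refine Fin.cases ?_ (fun j => ?_) i
  · exact Or.inl ⟨rfl, rfl⟩
  · exact Or.inr ⟨j, rfl, rfl⟩

lemma exists_tgtSeq_eq (mid : Fin r → V × V) (z : V) (i : Fin (r + 1)) :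
    (i = Fin.last r ∧ tgtSeq mid z i = z) ∨
      ∃ j : Fin r, i = j.castSucc ∧ tgtSeq mid z i = (mid j).1 := by
  refine Fin.lastCases ?_ (fun j => ?_) i
  · exact Or.inl ⟨rfl, by simp [tgtSeq]⟩
  · exact Or.inr ⟨j, rfl, by simp [tgtSeq]⟩

/-- The vertices `x, s, u₀, v₀, u₁, v₁, …, u_r, v_r, y` (where `v_r = z`) form a path that misses
`Z` internally, whose edges `s u₀`, `v_i u_{i+1}`, `z y` lie in `K` while the edges `u_i v_i` do
not. -/
structure IsPathTuple (K : SimpleGraph V) (Z : Finset V) (x y s u₀ z : V)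
    (mid : Fin r → V × V) : Prop where
  adj_start : K.Adj s u₀
  adj_mid : ∀ i, K.Adj (mid i).1 (mid i).2
  adj_end : K.Adj z y
  not_adj : ∀ i, ¬ K.Adj (srcSeq u₀ mid i) (tgtSeq mid z i)
  src_inj : Function.Injective (srcSeq u₀ mid)
  tgt_inj : Function.Injective (tgtSeq mid z)
  src_ne_tgt : ∀ i j, srcSeq u₀ mid i ≠ tgtSeq mid z j
  src_notMem : ∀ i, srcSeq u₀ mid i ∉ Z
  tgt_notMem : ∀ i, tgtSeq mid z i ∉ Z
  start_notMem : s ∉ Z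
  src_ne : ∀ i, srcSeq u₀ mid i ≠ x ∧ srcSeq u₀ mid i ≠ y ∧ srcSeq u₀ mid i ≠ s
  tgt_ne : ∀ i, tgtSeq mid z i ≠ x ∧ tgtSeq mid z i ≠ y ∧ tgtSeq mid z i ≠ s
  x_ne_y : x ≠ y
  x_ne_s : x ≠ s
  s_ne_y : s ≠ y

lemma IsPathTuple.edge_injective {K : SimpleGraph V} {Z : Finset V} {x y s u₀ z : V} {mid : Fin r → V × V}
    (h : IsPathTuple K Z x y s u₀ z mid) :
    Function.Injective fun i => s(srcSeq u₀ mid i, tgtSeq mid z i) := by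
  intro i j hij
  rcases Sym2.eq_iff.1 hij with ⟨h1, _⟩ | ⟨h1, _⟩
  · exact h.src_inj h1
  · exact absurd h1 (h.src_ne_tgt i j)

/-- The non-`K` edges of the path encoded by a tuple, except for the first one. -/
def pathEdges [DecidableEq V] (Q : V × V × V × (Fin r → V × V)) : Finset (Sym2 V) :=
  univ.image fun i => s(srcSeq Q.2.1 Q.2.2.2 i, tgtSeq Q.2.2.2 Q.2.2.1 i)

lemma IsPathTuple.card_pathEdges [DecidableEq V] {K : SimpleGraph V} {Z : Finset V} {x y : V} {Q : V × V × V × (Fin r → V × V)}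
    (h : IsPathTuple K Z x y Q.1 Q.2.1 Q.2.2.1 Q.2.2.2) : #(pathEdges Q) = r + 1 := by
  unfold pathEdges
  rw [card_image_of_injective _ h.edge_injective]
  simp

variable [Fintype V] [DecidableEq V] {K : SimpleGraph V}

lemma mem_blocked {S Z : Finset V} {x y s u₀ z w : V} :
    w ∈ blocked K S Z x y s u₀ z ↔ (w ∈ Z ∨ w = x ∨ w = y ∨ w = s ∨ w = u₀ ∨ w = z) ∨
      K.Adj y w ∨ K.Adj u₀ w ∨ K.Adj z w ∨ ∃ t ∈ S, K.Adj t w := by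
  simp only [blocked, mem_union, mem_insert, mem_singleton, mem_biUnion, mem_filter, mem_univ,
    true_and]

lemma isPathTuple_of_mem_goodTuples {S Z : Finset V} {x y : V} (hr : r ≠ 0) (hxy : x ≠ y)
    (hxS : x ∉ S) (hyS : y ∉ S) (hSZ : Disjoint S Z) {Q : V × V × V × (Fin r → V × V)}
    (hQ : Q ∈ goodTuples K S Z x y r) :
    IsPathTuple K Z x y Q.1 Q.2.1 Q.2.2.1 Q.2.2.2 := by
  obtain ⟨s, u₀, z, mid⟩ := Q
  obtain ⟨hz, hs, hm⟩ := (mem_filter.1 hQ).2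
  dsimp only at hz hs hm ⊢
  obtain ⟨hyz, hzZ⟩ := (mem_filter.1 hz).2
  obtain ⟨hsu, hsS, hsz, huZ⟩ := (mem_filter.1 hs).2
  obtain ⟨hfree, hcomp⟩ := (mem_filter.1 hm).2
  simp only [mem_union, mem_singleton, mem_insert, not_or] at hzZ huZ
  dsimp only at hsu hsS hsz
  have hfree' : ∀ i, K.Adj (mid i).1 (mid i).2 ∧ (mid i).1 ∉ blocked K S Z x y s u₀ z ∧
      (mid i).2 ∉ blocked K S Z x y s u₀ z := fun i => (mem_filter.1 (hfree i)).2
  simp only [mem_blocked, not_or] at hfree'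
  have hsZ : s ∉ Z := disjoint_left.1 hSZ hsS
  have hsx : x ≠ s := fun h => hxS (h ▸ hsS)
  have hsy : s ≠ y := fun h => hyS (h ▸ hsS)
  have hyz' := hyz.ne
  have hsu' := hsu.ne
  have hne : ∀ i j, i ≠ j → (mid i).2 ≠ (mid j).2 ∧ (mid i).1 ≠ (mid j).1 ∧
      (mid i).2 ≠ (mid j).1 := by
    intro i j hij
    rcases lt_or_gt_of_ne hij with h | h
    · have := hcomp i j h
      unfold Compatible at this
      tauto
    · have := hcomp j i h
      unfold Compatible at this
      exact ⟨this.2.1.symm, this.1.symm, fun h => this.2.2.1 h.symm⟩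
  have hneq : ∀ i j, (mid i).2 ≠ (mid j).1 := by
    intro i j
    by_cases h : i = j
    · subst h
      exact (hfree' i).1.ne'
    · exact (hne i j h).2.2
  refine
    { adj_start := hsu
      adj_mid := fun i => (hfree' i).1
      adj_end := hyz.symm
      not_adj := ?_
      src_inj := ?_
      tgt_inj := ?_
      src_ne_tgt := ?_
      src_notMem := ?_
      tgt_notMem := ?_
      start_notMem := hsZ
      src_ne := ?_
      tgt_ne := ?_
      x_ne_y := hxy
      x_ne_s := hsx
      s_ne_y := hsy }
  · intro i
    rcases exists_srcSeq_eq u₀ mid i with ⟨hi, h⟩ | ⟨j, hi, h⟩ <;>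
      rcases exists_tgtSeq_eq mid z i with ⟨hi', h'⟩ | ⟨j', hi', h'⟩ <;> rw [h, h']
    · rw [hi] at hi'
      exact absurd (Fin.ext_iff.1 hi').symm hr
    · have := hfree' j'
      tauto
    · have h1 := hfree' j
      rw [K.adj_comm]
      tauto
    · have hjj : j < j' := by
        have := hi.symm.trans hi'
        rw [Fin.ext_iff] at this
        simp only [Fin.val_succ, Fin.val_castSucc] at this
        rw [Fin.lt_def]
        omega
      exact (hcomp j j' hjj).2.2.2.2
  · intro i j hij
    rcases exists_srcSeq_eq u₀ mid i with ⟨hi, h⟩ | ⟨k, hi, h⟩ <;>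
      rcases exists_srcSeq_eq u₀ mid j with ⟨hj, h'⟩ | ⟨k', hj, h'⟩ <;> rw [h, h'] at hij
    · rw [hi, hj]
    · exact absurd hij.symm (by have := hfree' k'; tauto)
    · exact absurd hij (by have := hfree' k; tauto)
    · by_cases hk : k = k'
      · rw [hi, hj, hk]
      · exact absurd hij (hne k k' hk).1
  · intro i j hij
    rcases exists_tgtSeq_eq mid z i with ⟨hi, h⟩ | ⟨k, hi, h⟩ <;>
      rcases exists_tgtSeq_eq mid z j with ⟨hj, h'⟩ | ⟨k', hj, h'⟩ <;> rw [h, h'] at hij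
    · rw [hi, hj]
    · exact absurd hij.symm (by have := hfree' k'; tauto)
    · exact absurd hij (by have := hfree' k; tauto)
    · by_cases hk : k = k'
      · rw [hi, hj, hk]
      · exact absurd hij (hne k k' hk).2.1
  · intro i j
    rcases exists_srcSeq_eq u₀ mid i with ⟨hi, h⟩ | ⟨k, hi, h⟩ <;>
      rcases exists_tgtSeq_eq mid z j with ⟨hj, h'⟩ | ⟨k', hj, h'⟩ <;> rw [h, h']
    · tauto
    · have := hfree' k'
      exact fun h => this.2.1.1.2.2.2.2.1 h.symm
    · have := hfree' k
      tauto
    · exact hneq k k'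
  · intro i
    rcases exists_srcSeq_eq u₀ mid i with ⟨hi, h⟩ | ⟨k, hi, h⟩ <;> rw [h]
    · tauto
    · have := hfree' k
      tauto
  · intro i
    rcases exists_tgtSeq_eq mid z i with ⟨hi, h⟩ | ⟨k, hi, h⟩ <;> rw [h]
    · tauto
    · have := hfree' k
      tauto
  · intro i
    rcases exists_srcSeq_eq u₀ mid i with ⟨hi, h⟩ | ⟨k, hi, h⟩ <;> rw [h]
    · exact ⟨by tauto, by tauto, hsu'.symm⟩
    · have := hfree' k
      tauto
  · intro i
    rcases exists_tgtSeq_eq mid z i with ⟨hi, h⟩ | ⟨k, hi, h⟩ <;> rw [h]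
    · exact ⟨by tauto, hyz'.symm, fun h => hsz h.symm⟩
    · have := hfree' k
      tauto

lemma sum_endpoints_le {S Z : Finset V} {x y : V} {Q : V × V × V × (Fin r → V × V)}
    (hQ : Q ∈ goodTuples K S Z x y r) {f : V → ℝ} {c : ℝ} (hf : ∀ v, f v ≤ c)
    (hf0 : ∀ v, v ∉ blocked K S Z x y Q.1 Q.2.1 Q.2.2.1 → f v = 0) :
    ∑ i, f (srcSeq Q.2.1 Q.2.2.2 i) + ∑ i, f (tgtSeq Q.2.2.2 Q.2.2.1 i) ≤ 2 * c := by
  obtain ⟨s, u₀, z, mid⟩ := Q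
  obtain ⟨hz, hs, hm⟩ := (mem_filter.1 hQ).2
  have hfree := fun i => (mem_filter.1 ((mem_filter.1 hm).2.1 i)).2
  rw [Fin.sum_univ_succ, Fin.sum_univ_castSucc (fun i => f (tgtSeq mid z i))]
  have h1 : ∀ i, f (srcSeq u₀ mid (Fin.succ i)) = 0 := fun i => hf0 _ (hfree i).2.2
  have h2 : ∀ i, f (tgtSeq mid z (Fin.castSucc i)) = 0 := fun i => by
    have : tgtSeq mid z (Fin.castSucc i) = (mid i).1 := by simp [tgtSeq]
    rw [this]
    exact hf0 _ (hfree i).2.1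
  simp only [h1, h2, sum_const_zero, add_zero, zero_add]
  linarith [hf (srcSeq u₀ mid 0), hf (tgtSeq mid z (Fin.last r))]

/-- The indicator of adjacency. -/
def adjInd (K : SimpleGraph V) (v u : V) : ℝ := if K.Adj v u then 1 else 0

lemma sum_goodTuples_le (S Z : Finset V) (x y : V) {f : V → (Fin r → V × V) → V → ℝ}
    (hf : ∀ u₀ mid z, 0 ≤ f u₀ mid z) :
    ∑ Q ∈ goodTuples K S Z x y r, f Q.2.1 Q.2.2.2 Q.2.2.1 ≤
      ∑ u₀, ∑ mid, ∑ z, (∑ t ∈ S, adjInd K t u₀) * (∏ i, adjInd K (mid i).1 (mid i).2) *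
        f u₀ mid z * adjInd K y z := by
  have h0 : ∀ v u, 0 ≤ adjInd K v u := fun v u => by unfold adjInd; split_ifs <;> norm_num
  calc ∑ Q ∈ goodTuples K S Z x y r, f Q.2.1 Q.2.2.2 Q.2.2.1
      ≤ ∑ Q ∈ S ×ˢ (univ : Finset (V × V × (Fin r → V × V))),
        adjInd K Q.1 Q.2.1 * (∏ i, adjInd K (Q.2.2.2 i).1 (Q.2.2.2 i).2) *
          f Q.2.1 Q.2.2.2 Q.2.2.1 * adjInd K y Q.2.2.1 := by
        refine (sum_le_sum fun Q hQ => le_of_eq ?_).trans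
          (sum_le_sum_of_subset_of_nonneg (s := goodTuples K S Z x y r) ?_ ?_)
        · obtain ⟨hz, hs, hm⟩ := (mem_filter.1 hQ).2
          have hfree := fun i => (mem_filter.1 ((mem_filter.1 hm).2.1 i)).2.1
          have h1 : adjInd K Q.1 Q.2.1 = 1 := if_pos (mem_filter.1 hs).2.1
          have h2 : adjInd K y Q.2.2.1 = 1 := if_pos (mem_filter.1 hz).2.1
          have h3 : ∏ i, adjInd K (Q.2.2.2 i).1 (Q.2.2.2 i).2 = 1 :=
            prod_eq_one fun i _ => if_pos (hfree i)
          rw [h1, h2, h3]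
          ring
        · intro Q hQ
          obtain ⟨hz, hs, hm⟩ := (mem_filter.1 hQ).2
          exact mem_product.2 ⟨(mem_filter.1 hs).2.2.1, mem_univ _⟩
        · intro Q _ _
          exact mul_nonneg (mul_nonneg (mul_nonneg (h0 _ _) (prod_nonneg fun i _ => h0 _ _))
            (hf _ _ _)) (h0 _ _)
    _ = _ := by
        rw [sum_product, sum_comm]
        simp only [Fintype.sum_prod_type]
        refine sum_congr rfl fun u₀ _ => ?_
        rw [sum_comm]
        refine sum_congr rfl fun mid _ => sum_congr rfl fun z _ => ?_
        simp only [sum_mul]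

omit [DecidableEq V] in
lemma sum_adjInd {d : ℕ} (hK : ∀ v, #{u | K.Adj v u} = d) (v : V) :
    ∑ u, adjInd K v u = d := by
  simp [adjInd, hK]

omit [DecidableEq V] in
lemma sum_adjInd' {d : ℕ} (hK : ∀ v, #{u | K.Adj v u} = d) (u : V) :
    ∑ v, adjInd K v u = d := by
  rw [← sum_adjInd hK u]
  simp only [adjInd, K.adj_comm]

lemma pow_mul_card_goodTuples_le {d : ℕ} (hK : ∀ v, #{u | K.Adj v u} = d) (S Z : Finset V)
    (x y : V) {p : ℝ} (hp : 0 ≤ p) :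
    p ^ (r + 1) * #(goodTuples K S Z x y r)
      ≤ p * d * (((Fintype.card V : ℝ) * d * p) ^ r * (d * #S)) := by
  have h := sum_goodTuples_le (K := K) S Z x y (r := r) (f := fun _ _ _ => p ^ (r + 1))
    fun _ _ _ => pow_nonneg hp _
  have h2 := walkSum_const (A := adjInd K) (sum_adjInd hK) p (adjInd K y) r
    (fun u => ∑ t ∈ S, adjInd K t u)
  rw [sum_comm (s := univ) (t := S)] at h2
  simp only [sum_adjInd hK, sum_const, nsmul_eq_mul] at h2 h
  rw [mul_comm (p ^ (r + 1))]
  refine h.trans (le_of_eq ?_)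
  rw [mul_comm (d : ℝ) (#S), ← h2]
  simp [walkSum]

end PathEdges

section Overlap

open Finset

variable {V : Type*} [Fintype V] [DecidableEq V] {K : SimpleGraph V} {r : ℕ}

omit [Fintype V] in
lemma pathEdges_weight_le {Z : Finset V} {x y : V} {P Q : V × V × V × (Fin r → V × V)}
    (hQ : IsPathTuple K Z x y Q.1 Q.2.1 Q.2.2.1 Q.2.2.2) {p : ℝ} (hp : 0 ≤ p)
    (hPQ : ¬ Disjoint (pathEdges P) (pathEdges Q)) {W : V → V → ℝ}
    (hWp : ∀ u v, p ≤ W u v) (hW : ∀ u v, s(u, v) ∈ pathEdges P → p + 1 ≤ W u v) :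
    p ^ #(pathEdges Q \ pathEdges P) + p ^ (r + 1)
      ≤ ∏ i, W (srcSeq Q.2.1 Q.2.2.2 i) (tgtSeq Q.2.2.2 Q.2.2.1 i) := by
  set e : Fin (r + 1) → Sym2 V := fun i => s(srcSeq Q.2.1 Q.2.2.2 i, tgtSeq Q.2.2.2 Q.2.2.1 i)
    with he
  have hcard := hQ.card_pathEdges
  have hsdiff : #(pathEdges Q \ pathEdges P) + #(pathEdges Q ∩ pathEdges P) = r + 1 := by
    rw [card_sdiff_add_card_inter, hcard]
  have hpos : 1 ≤ #(pathEdges Q ∩ pathEdges P) := by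
    rw [disjoint_comm, disjoint_iff_inter_eq_empty] at hPQ
    exact card_pos.2 (nonempty_iff_ne_empty.2 hPQ)
  have hprod : p ^ #(pathEdges Q \ pathEdges P) * (p + 1) ^ #(pathEdges Q ∩ pathEdges P)
      = ∏ i, if e i ∈ pathEdges P then p + 1 else p := by
    have h1 : ∏ i, (if e i ∈ pathEdges P then p + 1 else p)
        = ∏ f ∈ pathEdges Q, if f ∈ pathEdges P then p + 1 else p := by
      unfold pathEdges
      rw [prod_image (fun i _ j _ h => hQ.edge_injective h)]
    rw [h1, prod_ite, prod_const, prod_const, filter_mem_eq_inter, filter_notMem_eq_sdiff,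
      mul_comm]
  have h2 : p ^ #(pathEdges Q ∩ pathEdges P) + 1 ≤ (p + 1) ^ #(pathEdges Q ∩ pathEdges P) := by
    simpa using pow_add_pow_le hp zero_le_one (by omega : #(pathEdges Q ∩ pathEdges P) ≠ 0)
  calc p ^ #(pathEdges Q \ pathEdges P) + p ^ (r + 1)
      = p ^ #(pathEdges Q \ pathEdges P) * (p ^ #(pathEdges Q ∩ pathEdges P) + 1) := by
        rw [← hsdiff, pow_add]; ring
    _ ≤ p ^ #(pathEdges Q \ pathEdges P) * (p + 1) ^ #(pathEdges Q ∩ pathEdges P) :=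
        mul_le_mul_of_nonneg_left h2 (pow_nonneg hp _)
    _ = _ := hprod
    _ ≤ _ := by
        refine prod_le_prod (fun i _ => by split_ifs <;> linarith) fun i _ => ?_
        split_ifs with h
        · exact hW _ _ h
        · exact hWp _ _

lemma sum_overlap_le {d k : ℕ} (hd : 0 < d) (hK : ∀ v, #{u | K.Adj v u} = d) {S Z : Finset V}
    {x y : V} (hxy : x ≠ y) (hxS : x ∉ S) (hyS : y ∉ S) (hSZ : Disjoint S Z) {p D : ℝ}
    (hp : 0 < p) (hD : D = (Fintype.card V : ℝ) * d * p) (hS : 1 ≤ #S)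
    (hLD : 2 * (2 * (k + 2) : ℝ) ≤ D) (hNL : (Fintype.card V : ℝ) * (2 * (k + 2)) ^ k ≤ D ^ k)
    (hkN : 4 * (k + 1) * d * (2 * (k + 2)) ≤ (Fintype.card V : ℝ)) (hDs : 4 * d ≤ D * #S)
    {P : V × V × V × (Fin (k + 1) → V × V)} (hP : P ∈ goodTuples K S Z x y (k + 1)) :
    ∑ Q ∈ goodTuples K S Z x y (k + 1) with ¬ Disjoint (pathEdges P) (pathEdges Q),
        p ^ #(pathEdges Q \ pathEdges P)
      ≤ p * d * (D ^ (k + 1) * (d * #S)) * (21 / D + 8 * d / (D * #S)) := by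
  have hgood := fun Q (hQ : Q ∈ goodTuples K S Z x y (k + 1)) =>
    isPathTuple_of_mem_goodTuples (Nat.succ_ne_zero k) hxy hxS hyS hSZ hQ
  set src : Fin (k + 2) ⊕ Fin (k + 2) → V :=
    Sum.elim (srcSeq P.2.1 P.2.2.2) (tgtSeq P.2.2.2 P.2.2.1) with hsrc
  set tgt : Fin (k + 2) ⊕ Fin (k + 2) → V :=
    Sum.elim (tgtSeq P.2.2.2 P.2.2.1) (srcSeq P.2.1 P.2.2.2) with htgt
  set W : V → V → ℝ := fun u v => p + ∑ j, if src j = u ∧ tgt j = v then (1 : ℝ) else 0 with hWdef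
  have hnn : ∀ u v j, (0 : ℝ) ≤ if src j = u ∧ tgt j = v then (1 : ℝ) else 0 := by
    intro u v j; split_ifs <;> norm_num
  have hWp : ∀ u v, p ≤ W u v := fun u v =>
    le_add_of_nonneg_right (sum_nonneg fun j _ => hnn u v j)
  have hW : ∀ u v, s(u, v) ∈ pathEdges P → p + 1 ≤ W u v := by
    intro u v huv
    obtain ⟨i, _, hi⟩ := mem_image.1 huv
    have key : ∃ j, src j = u ∧ tgt j = v := by
      rcases Sym2.eq_iff.1 hi with ⟨h1, h2⟩ | ⟨h1, h2⟩
      · exact ⟨Sum.inl i, h1, h2⟩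
      · exact ⟨Sum.inr i, h2, h1⟩
    obtain ⟨j, hj⟩ := key
    have := single_le_sum (fun j _ => hnn u v j) (mem_univ j)
    rw [if_pos hj] at this
    exact add_le_add_right this p
  set f : V → (Fin (k + 1) → V × V) → V → ℝ := fun u₀ mid z =>
    (∏ i, W (srcSeq u₀ mid i) (tgtSeq mid z i)) - p ^ (k + 2) with hf
  have hf0 : ∀ u₀ mid z, 0 ≤ f u₀ mid z := by
    intro u₀ mid z
    have : ∏ _i : Fin (k + 2), p ≤ ∏ i, W (srcSeq u₀ mid i) (tgtSeq mid z i) :=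
      prod_le_prod (fun _ _ => hp.le) fun i _ => hWp _ _
    rw [prod_const, card_univ, Fintype.card_fin] at this
    exact sub_nonneg.2 this
  have hA0 : ∀ v u, 0 ≤ adjInd K v u := fun v u => by unfold adjInd; split_ifs <;> norm_num
  have hA1 : ∀ v u, adjInd K v u ≤ 1 := fun v u => by unfold adjInd; split_ifs <;> norm_num
  set a : V → ℝ := fun u => ∑ t ∈ S, adjInd K t u with ha
  have hasum : ∑ u, a u = d * #S := by
    rw [ha, sum_comm]
    simp only [sum_adjInd hK, sum_const, nsmul_eq_mul]
    ring
  have hb2 : ∑ j, adjInd K y (tgt j) ≤ 2 := by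
    have := sum_endpoints_le hP (f := adjInd K y) (c := 1) (hA1 y) fun v hv => by
      rw [mem_blocked] at hv
      exact if_neg (by tauto)
    rw [Fintype.sum_sum_type, add_comm]
    exact this.trans_eq (mul_one 2)
  have ha2 : ∑ j, a (src j) ≤ 2 * d := by
    have := sum_endpoints_le hP (f := a) (c := d) (fun v => by
        rw [← sum_adjInd' hK v]
        exact sum_le_sum_of_subset_of_nonneg (subset_univ S) fun t _ _ => hA0 t v) fun v hv => by
      rw [mem_blocked] at hv
      refine sum_eq_zero fun t ht => if_neg fun h => ?_
      exact hv (Or.inr (Or.inr (Or.inr (Or.inr ⟨t, ht, h⟩))))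
    rw [Fintype.sum_sum_type]
    exact this
  obtain ⟨σ, β, hσ0, hβ0, hσnn, hβnn, hσ, hβ, hle⟩ := walkSum_le_of_perturbation hA0 hA1
    (sum_adjInd hK) (sum_adjInd' hK) hp.le src tgt (hA0 y) (sum_adjInd hK y) hb2
    (a := a) (fun v => sum_nonneg fun t _ => hA0 t v) k
  have hdpos : (0 : ℝ) < d := Nat.cast_pos.2 hd
  have hcard : (0 : ℝ) < Fintype.card V := Nat.cast_pos.2 (Fintype.card_pos_iff.2 ⟨x⟩)
  have hDpos : 0 < D := by rw [hD]; positivity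
  have hJ : (Fintype.card (Fin (k + 2) ⊕ Fin (k + 2)) : ℝ) = 2 * (k + 2) := by
    simp [Fintype.card_sum]; ring
  have hD1 : 1 ≤ D := by
    have : (0 : ℝ) ≤ k := Nat.cast_nonneg k
    linarith
  have hgrow := perturbed_growth_bound (σ := σ) (β := β) (d := d) (s := #S) (q := p * d)
    (D := D) (L := 2 * (k + 2)) (N := Fintype.card V) (k := k) hdpos (by exact_mod_cast hS) hD1
    (by positivity) hcard (by rw [hD]; field_simp) hβnn (hσ0.trans hasum)
    (hβ0.trans_le ha2) (fun i => by rw [hσ i, hD])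
    (fun i => (hβ i).trans_eq (by rw [hJ])) hLD hNL hkN hDs
  have hconst : walkSum (fun _ _ => p) (adjInd K) (adjInd K y) (k + 1) a
      = p * d * (D ^ (k + 1) * (d * #S)) := by
    rw [walkSum_const (sum_adjInd hK), hasum, sum_adjInd hK, hD]
  have hsum : ∑ u₀, ∑ mid : Fin (k + 1) → V × V, ∑ z, a u₀ *
      (∏ i, adjInd K (mid i).1 (mid i).2) * f u₀ mid z * adjInd K y z
      = walkSum W (adjInd K) (adjInd K y) (k + 1) a
        - walkSum (fun _ _ => p) (adjInd K) (adjInd K y) (k + 1) a := by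
    unfold walkSum
    simp only [← sum_sub_distrib]
    refine sum_congr rfl fun u₀ _ => sum_congr rfl fun mid _ => sum_congr rfl fun z _ => ?_
    simp only [hf, prod_const, card_univ, Fintype.card_fin]
    ring
  calc ∑ Q ∈ goodTuples K S Z x y (k + 1) with ¬ Disjoint (pathEdges P) (pathEdges Q),
        p ^ #(pathEdges Q \ pathEdges P)
      ≤ ∑ Q ∈ goodTuples K S Z x y (k + 1) with ¬ Disjoint (pathEdges P) (pathEdges Q),
        f Q.2.1 Q.2.2.2 Q.2.2.1 := by
        refine sum_le_sum fun Q hQ => ?_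
        obtain ⟨hQ1, hQ2⟩ := mem_filter.1 hQ
        have := pathEdges_weight_le (hgood Q hQ1) hp.le hQ2 hWp hW
        exact le_sub_iff_add_le.2 this
    _ ≤ ∑ Q ∈ goodTuples K S Z x y (k + 1), f Q.2.1 Q.2.2.2 Q.2.2.1 :=
        sum_le_sum_of_subset_of_nonneg (filter_subset _ _) fun Q _ _ => hf0 _ _ _
    _ ≤ _ := sum_goodTuples_le S Z x y hf0
    _ = _ := hsum
    _ ≤ p * d * (d * #S) * D ^ (k + 1) * (1 + (21 / D + 8 * d / (D * #S)))
        - p * d * (D ^ (k + 1) * (d * #S)) := by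
        rw [hconst]
        exact sub_le_sub_right (hle.trans hgrow) _
    _ = _ := by ring

end Overlap

section PathCount

open Finset

variable {V : Type*} {r : ℕ}

/-- The vertex sequence `x, s, u₀, v₀, …, u_r, v_r, y`. -/
def pathSeq (x y s : V) (u v : Fin (r + 1) → V) (j : ℕ) : V :=
  if j = 0 then x else if j = 1 then s else
    if h : (j - 2) / 2 < r + 1 then (if j % 2 = 0 then u ⟨(j - 2) / 2, h⟩ else v ⟨(j - 2) / 2, h⟩)
    else y

section

variable (x y s : V) (u v : Fin (r + 1) → V)

lemma pathSeq_zero : pathSeq x y s u v 0 = x := by simp [pathSeq]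

lemma pathSeq_one : pathSeq x y s u v 1 = s := by simp [pathSeq]

lemma pathSeq_even (i : Fin (r + 1)) : pathSeq x y s u v (2 * i + 2) = u i := by
  unfold pathSeq
  rw [if_neg (by omega), if_neg (by omega), dif_pos (by omega), if_pos (by omega)]
  congr 1
  exact Fin.ext (by simp only []; omega)

lemma pathSeq_odd (i : Fin (r + 1)) : pathSeq x y s u v (2 * i + 3) = v i := by
  unfold pathSeq
  rw [if_neg (by omega), if_neg (by omega), dif_pos (by omega), if_neg (by omega)]
  congr 1
  exact Fin.ext (by simp only []; omega)

lemma pathSeq_last : pathSeq x y s u v (2 * r + 4) = y := by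
  unfold pathSeq
  rw [if_neg (by omega), if_neg (by omega), dif_neg (by omega)]

end

lemma pathSeq_index_cases {j : ℕ} (hj : j ≤ 2 * r + 4) :
    j = 0 ∨ j = 1 ∨ (∃ i : Fin (r + 1), j = 2 * i + 2) ∨ (∃ i : Fin (r + 1), j = 2 * i + 3) ∨
      j = 2 * r + 4 := by
  by_cases h0 : j = 0
  · exact Or.inl h0
  by_cases h1 : j = 1
  · exact Or.inr (Or.inl h1)
  by_cases hl : j = 2 * r + 4
  · exact Or.inr (Or.inr (Or.inr (Or.inr hl)))
  rcases Nat.even_or_odd' j with ⟨i, hi | hi⟩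
  · exact Or.inr (Or.inr (Or.inl ⟨⟨i - 1, by omega⟩, by simp only []; omega⟩))
  · exact Or.inr (Or.inr (Or.inr (Or.inl ⟨⟨i - 1, by omega⟩, by simp only []; omega⟩)))

lemma IsPathTuple.pathSeq_injOn {K : SimpleGraph V} {Z : Finset V} {x y s u₀ z : V}
    {mid : Fin r → V × V} (h : IsPathTuple K Z x y s u₀ z mid) {i j : ℕ} (hi : i ≤ 2 * r + 4)
    (hj : j ≤ 2 * r + 4)
    (hij : pathSeq x y s (srcSeq u₀ mid) (tgtSeq mid z) i
      = pathSeq x y s (srcSeq u₀ mid) (tgtSeq mid z) j) : i = j := by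
  rcases pathSeq_index_cases hi with rfl | rfl | ⟨i, rfl⟩ | ⟨i, rfl⟩ | rfl <;>
    rcases pathSeq_index_cases hj with rfl | rfl | ⟨j, rfl⟩ | ⟨j, rfl⟩ | rfl <;>
    simp only [pathSeq_zero, pathSeq_one, pathSeq_even, pathSeq_odd, pathSeq_last] at hij
  · rfl
  · exact absurd hij h.x_ne_s
  · exact absurd hij.symm (h.src_ne j).1
  · exact absurd hij.symm (h.tgt_ne j).1
  · exact absurd hij h.x_ne_y
  · exact absurd hij.symm h.x_ne_s
  · rfl
  · exact absurd hij.symm (h.src_ne j).2.2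
  · exact absurd hij.symm (h.tgt_ne j).2.2
  · exact absurd hij h.s_ne_y
  · exact absurd hij (h.src_ne i).1
  · exact absurd hij (h.src_ne i).2.2
  · rw [h.src_inj hij]
  · exact absurd hij (h.src_ne_tgt i j)
  · exact absurd hij (h.src_ne i).2.1
  · exact absurd hij (h.tgt_ne i).1
  · exact absurd hij (h.tgt_ne i).2.2
  · exact absurd hij.symm (h.src_ne_tgt j i)
  · rw [h.tgt_inj hij]
  · exact absurd hij (h.tgt_ne i).2.1
  · exact absurd hij.symm h.x_ne_y
  · exact absurd hij.symm h.s_ne_y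
  · exact absurd hij.symm (h.src_ne j).2.1
  · exact absurd hij.symm (h.tgt_ne j).2.1
  · rfl

lemma tuple_eq_of_pathSeq_eq {x y : V} {Q Q' : V × V × V × (Fin r → V × V)}
    (h : ∀ j ≤ 2 * r + 4, pathSeq x y Q.1 (srcSeq Q.2.1 Q.2.2.2) (tgtSeq Q.2.2.2 Q.2.2.1) j
      = pathSeq x y Q'.1 (srcSeq Q'.2.1 Q'.2.2.2) (tgtSeq Q'.2.2.2 Q'.2.2.1) j) : Q = Q' := by
  obtain ⟨s, u₀, z, mid⟩ := Q
  obtain ⟨s', u₀', z', mid'⟩ := Q'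
  dsimp only at h
  have hsrc : ∀ i : Fin (r + 1), srcSeq u₀ mid i = srcSeq u₀' mid' i := fun i => by
    have := h (2 * i + 2) (by omega)
    rwa [pathSeq_even, pathSeq_even] at this
  have htgt : ∀ i : Fin (r + 1), tgtSeq mid z i = tgtSeq mid' z' i := fun i => by
    have := h (2 * i + 3) (by omega)
    rwa [pathSeq_odd, pathSeq_odd] at this
  have hs : s = s' := by
    have := h 1 (by omega)
    rwa [pathSeq_one, pathSeq_one] at this
  have hu : u₀ = u₀' := hsrc 0
  have hz : z = z' := by simpa [tgtSeq] using htgt (Fin.last r)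
  have hm : mid = mid' := by
    funext i
    have h1 : (mid i).2 = (mid' i).2 := by simpa [srcSeq] using hsrc i.succ
    have h2 : (mid i).1 = (mid' i).1 := by simpa [tgtSeq] using htgt i.castSucc
    exact Prod.ext h2 h1
  rw [hs, hu, hz, hm]

lemma isAltSeq_pathSeq {K G : SimpleGraph (Fin n)} {Z : Finset (Fin n)} {x y s u₀ z : Fin n}
    {mid : Fin r → Fin n × Fin n} (h : IsPathTuple K Z x y s u₀ z mid) (hs : G.Adj x s)
    (hG : ∀ i, G.Adj (srcSeq u₀ mid i) (tgtSeq mid z i)) :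
    IsAltSeq G K (2 * (r + 2)) fun j => pathSeq x y s (srcSeq u₀ mid) (tgtSeq mid z) j := by
  refine ⟨fun i j hij => Fin.ext (h.pathSeq_injOn (by omega) (by omega) hij), fun i => ?_⟩
  obtain ⟨i, hi⟩ := i
  simp only [Fin.castSucc_mk, Fin.succ_mk]
  rcases pathSeq_index_cases (r := r) (j := i) (by omega) with rfl | rfl | ⟨j, rfl⟩ | ⟨j, rfl⟩ | rfl
  · simpa [pathSeq_zero, pathSeq_one] using hs
  · have := pathSeq_even x y s (srcSeq u₀ mid) (tgtSeq mid z) 0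
    simp only [Fin.val_zero, mul_zero, zero_add] at this
    rw [if_neg (by omega), pathSeq_one, this]
    exact h.adj_start
  · rw [if_pos (by omega), pathSeq_even, show 2 * (j : ℕ) + 2 + 1 = 2 * j + 3 by ring, pathSeq_odd]
    exact hG j
  · rw [if_neg (by omega), pathSeq_odd]
    rcases exists_tgtSeq_eq mid z j with ⟨hj, h'⟩ | ⟨k, hj, h'⟩
    · have hj' : (j : ℕ) = r := by rw [hj]; rfl
      rw [h', show 2 * (j : ℕ) + 3 + 1 = 2 * r + 4 by omega, pathSeq_last]
      exact h.adj_end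
    · have hj' : (j : ℕ) = k := by rw [hj]; rfl
      have := pathSeq_even x y s (srcSeq u₀ mid) (tgtSeq mid z) k.succ
      rw [Fin.val_succ] at this
      rw [h', show 2 * (j : ℕ) + 3 + 1 = 2 * (k + 1) + 2 by omega, this]
      exact h.adj_mid k
  · omega

lemma card_tuples_le_altPathCount {K G : SimpleGraph (Fin n)} {S Z : Finset (Fin n)} {x y : Fin n}
    (hr : r ≠ 0) (hxy : x ≠ y) (hxS : x ∉ S) (hyS : y ∉ S) (hSZ : Disjoint S Z)
    (hS : ∀ s ∈ S, G.Adj x s) {I : Finset (Fin n × Fin n × Fin n × (Fin r → Fin n × Fin n))}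
    (hI : ∀ Q ∈ I, Q ∈ goodTuples K S Z x y r ∧ ∀ e ∈ pathEdges Q, e ∈ G.edgeSet) :
    #I ≤ altPathCount G K (2 * (r + 2)) x y Z := by
  unfold altPathCount
  rw [Nat.card_eq_fintype_card, Fintype.card_subtype]
  refine card_le_card_of_injOn (fun Q j => pathSeq x y Q.1 (srcSeq Q.2.1 Q.2.2.2)
    (tgtSeq Q.2.2.2 Q.2.2.1) j) ?_ ?_
  · intro Q hQ
    obtain ⟨hQ1, hQ2⟩ := hI Q hQ
    have h := isPathTuple_of_mem_goodTuples hr hxy hxS hyS hSZ hQ1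
    have hs : G.Adj x Q.1 := hS _ (mem_filter.1 (mem_filter.1 hQ1).2.2.1).2.2.1
    refine mem_filter.2 ⟨mem_univ _, isAltSeq_pathSeq h hs fun i => ?_, ?_, ?_, ?_⟩
    · exact hQ2 _ (mem_image_of_mem _ (mem_univ i))
    · exact pathSeq_zero _ _ _ _ _
    · exact pathSeq_last _ _ _ _ _
    · intro i hi0 hil
      obtain ⟨i, hi⟩ := i
      have h0 : i ≠ 0 := fun h => hi0 (Fin.ext h)
      have hl : i ≠ 2 * (r + 2) := fun h => hil (Fin.ext h)
      rw [mem_coe]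
      dsimp only
      rcases pathSeq_index_cases (r := r) (j := i) (by omega) with
        rfl | rfl | ⟨j, rfl⟩ | ⟨j, rfl⟩ | rfl
      · exact absurd rfl h0
      · rw [pathSeq_one]
        exact h.start_notMem
      · rw [pathSeq_even]
        exact h.src_notMem j
      · rw [pathSeq_odd]
        exact h.tgt_notMem j
      · exact absurd (by ring) hl
  · intro Q _ Q' _ hQQ'
    exact tuple_eq_of_pathSeq_eq (x := x) (y := y) fun j hj =>
      congrFun hQQ' (⟨j, by omega⟩ : Fin (2 * (r + 2) + 1))

end PathCount

section TailBounds

open Finset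

variable {d : ℕ} {K : SimpleGraph (Fin n)}

/-- The probability that a pair is added to `K`. -/
def edgeProb (K : SimpleGraph (Fin n)) (p : ℝ) (e : Sym2 (Fin n)) : ℝ :=
  if e.IsDiag ∨ e ∈ K.edgeSet then 0 else p

lemma edgeProb_nonneg {p : ℝ} (hp : 0 ≤ p) (e : Sym2 (Fin n)) : 0 ≤ edgeProb K p e := by
  unfold edgeProb; split_ifs <;> linarith

lemma edgeProb_le_one {p : ℝ} (hp : p ≤ 1) (e : Sym2 (Fin n)) : edgeProb K p e ≤ 1 := by
  unfold edgeProb; split_ifs <;> linarith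

lemma edgeProb_pathEdges {r : ℕ} {Z : Finset (Fin n)} {x y : Fin n}
    {Q : Fin n × Fin n × Fin n × (Fin r → Fin n × Fin n)}
    (h : IsPathTuple K Z x y Q.1 Q.2.1 Q.2.2.1 Q.2.2.2) (p : ℝ) {e : Sym2 (Fin n)}
    (he : e ∈ pathEdges Q) : edgeProb K p e = p := by
  obtain ⟨i, _, rfl⟩ := mem_image.1 he
  refine if_neg ?_
  rintro (h1 | h1)
  · exact h.src_ne_tgt i i h1
  · exact h.not_adj i h1

/-- The neighbours of `x` in the graph with edge set `ω`. -/
def nbrs (ω : Finset (Sym2 (Fin n))) (x : Fin n) : Finset (Fin n) := {v | s(x, v) ∈ ω ∧ v ≠ x}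

lemma expect_card_nbrs_le (hK : ∀ v, #{u | K.Adj v u} = d) (x : Fin n) {p a m : ℝ} (hp : 0 < p)
    (hp1 : p ≤ 1) (ha : 0 ≤ a) (hm : m = ((n : ℝ) - 1 - d) * p) (hm0 : 0 < m) :
    expect (edgeProb K p) (fun ω => if (#(nbrs ω x) : ℝ) ≤ m - a then 1 else 0)
      ≤ Real.exp (-(a ^ 2 / (2 * m))) := by
  set I : Finset (Fin n) := {v | v ≠ x ∧ ¬ K.Adj x v} with hI
  have hIcard : #I + (d + 1) = n := by
    have h1 : Iᶜ = insert x (univ.filter (K.Adj x)) := by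
      ext v
      simp only [hI, mem_compl, mem_filter, mem_univ, true_and, mem_insert]
      tauto
    have h2 : #Iᶜ = d + 1 := by
      rw [h1, card_insert_of_notMem (by simp)]
      congr 1
      exact hK x
    have h3 := card_add_card_compl I
    rw [h2, Fintype.card_fin] at h3
    exact h3
  have hIc : (#I : ℝ) = n - 1 - d := by
    have : ((#I + (d + 1) : ℕ) : ℝ) = n := by rw [hIcard]
    push_cast at this
    linarith
  have hprob : ∀ v ∈ I, edgeProb K p s(x, v) = p := by
    intro v hv
    have hv' := (mem_filter.1 hv).2
    refine if_neg ?_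
    rintro (h | h)
    · exact hv'.1 (Sym2.mk_isDiag_iff.1 h).symm
    · exact hv'.2 h
  have hmem : ∀ v ∈ I, ∀ w ∈ I, s(x, v) = s(x, w) → v = w := by
    intro v _ w _ h
    exact Sym2.congr_right.1 h
  have hJ := janson_lower_tail (fun e => edgeProb_nonneg (K := K) hp.le e)
    (fun e => edgeProb_le_one (K := K) hp1 e) I (fun v => {s(x, v)}) ha hm0 (by
      calc ∑ i ∈ I, ∑ j ∈ I with ¬ Disjoint ({s(x, i)} : Finset (Sym2 (Fin n))) {s(x, j)},
            ∏ e ∈ ({s(x, i)} ∪ {s(x, j)} : Finset (Sym2 (Fin n))), edgeProb K p e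
          = ∑ i ∈ I, p := by
            refine sum_congr rfl fun i hi => ?_
            have : ({j ∈ I | ¬ Disjoint ({s(x, i)} : Finset (Sym2 (Fin n))) {s(x, j)}}
                : Finset (Fin n)) = {i} := by
              ext j
              simp only [mem_filter, disjoint_singleton, not_not, mem_singleton]
              exact ⟨fun h => (hmem i hi j h.1 h.2).symm, fun h => by subst h; exact ⟨hi, rfl⟩⟩
            rw [this, sum_singleton, union_self, prod_singleton, hprob i hi]
        _ ≤ m := by rw [sum_const, nsmul_eq_mul, hIc, hm])
  refine le_trans (expect_mono (fun e => edgeProb_nonneg (K := K) hp.le e)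
    (fun e => edgeProb_le_one (K := K) hp1 e) fun ω => ?_) hJ
  have h1 : ∑ i ∈ I, ∏ e ∈ ({s(x, i)} : Finset (Sym2 (Fin n))), edgeProb K p e = m := by
    rw [hm, ← hIc, ← nsmul_eq_mul, ← sum_const]
    exact sum_congr rfl fun i hi => by rw [prod_singleton, hprob i hi]
  have h2 : ∑ i ∈ I, (if ({s(x, i)} : Finset (Sym2 (Fin n))) ⊆ ω then (1 : ℝ) else 0)
      ≤ #(nbrs ω x) := by
    rw [← sum_filter, sum_const, nsmul_eq_mul, mul_one]
    refine Nat.cast_le.2 (card_le_card fun v hv => ?_)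
    obtain ⟨hv1, hv2⟩ := mem_filter.1 hv
    exact mem_filter.2 ⟨mem_univ _, singleton_subset_iff.1 hv2, (mem_filter.1 hv1).2.1⟩
  rw [h1]
  split_ifs with h3 h4
  · exact le_rfl
  · exact absurd (h2.trans h3) h4
  · exact zero_le_one
  · exact le_rfl

variable {k : ℕ} {Z : Finset (Fin n)} {x y : Fin n} {p D : ℝ}

lemma expect_card_tuples_le (hd : 0 < d) (hK : ∀ v, #{u | K.Adj v u} = d) {S : Finset (Fin n)}
    (hxy : x ≠ y) (hxS : x ∉ S) (hyS : y ∉ S) (hSZ : Disjoint S Z)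
    (hp : 0 < p) (hp1 : p ≤ 1) (hD : D = (n : ℝ) * d * p) (hS : 1 ≤ #S)
    (hLD : 2 * (2 * (k + 2) : ℝ) ≤ D) (hNL : (n : ℝ) * (2 * (k + 2)) ^ k ≤ D ^ k)
    (hkN : 4 * (k + 1) * d * (2 * (k + 2)) ≤ (n : ℝ)) (hDs : 4 * d ≤ D * #S) {t : ℝ}
    (ht : 0 ≤ t) :
    expect (edgeProb K p) (fun ω =>
        if (∑ Q ∈ goodTuples K S Z x y (k + 1), if pathEdges Q ⊆ ω then (1 : ℝ) else 0)
          ≤ p ^ (k + 2) * #(goodTuples K S Z x y (k + 1))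
            - t * (p * d * (D ^ (k + 1) * (d * #S))) then 1 else 0)
      ≤ Real.exp (-(t ^ 2 / (2 * (21 / D + 8 * d / (D * #S))))) := by
  set M : ℝ := p * d * (D ^ (k + 1) * (d * #S)) with hM
  set κ : ℝ := 21 / D + 8 * d / (D * #S) with hκ
  have hn : 0 < n := x.pos
  have hDpos : 0 < D := by rw [hD]; positivity
  have hMpos : 0 < M := by positivity
  have hκpos : 0 < κ := by positivity
  have hgood := fun Q (hQ : Q ∈ goodTuples K S Z x y (k + 1)) =>
    isPathTuple_of_mem_goodTuples (Nat.succ_ne_zero k) hxy hxS hyS hSZ hQ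
  have hsum := pow_mul_card_goodTuples_le (r := k + 1) hK S Z x y hp.le
  rw [Fintype.card_fin, ← hD, ← hM] at hsum
  have hJ := janson_lower_tail (fun e => edgeProb_nonneg (K := K) hp.le e)
    (fun e => edgeProb_le_one (K := K) hp1 e) (goodTuples K S Z x y (k + 1)) pathEdges
    (a := t * M) (Δ := κ * M ^ 2) (by positivity) (by positivity) (by
      calc ∑ P ∈ goodTuples K S Z x y (k + 1),
            ∑ Q ∈ goodTuples K S Z x y (k + 1) with ¬ Disjoint (pathEdges P) (pathEdges Q),
              ∏ e ∈ pathEdges P ∪ pathEdges Q, edgeProb K p e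
          = ∑ P ∈ goodTuples K S Z x y (k + 1), p ^ (k + 2) *
            ∑ Q ∈ goodTuples K S Z x y (k + 1) with ¬ Disjoint (pathEdges P) (pathEdges Q),
              p ^ #(pathEdges Q \ pathEdges P) := by
            refine sum_congr rfl fun P hP => ?_
            rw [mul_sum]
            refine sum_congr rfl fun Q hQ => ?_
            have hQ' := (mem_filter.1 hQ).1
            rw [prod_congr rfl (g := fun _ => p), prod_const, ← pow_add]
            · congr 1
              rw [← (hgood P hP).card_pathEdges, ← union_sdiff_self_eq_union,
                card_union_of_disjoint disjoint_sdiff]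
            · intro e he
              rcases mem_union.1 he with he | he
              · exact edgeProb_pathEdges (hgood P hP) p he
              · exact edgeProb_pathEdges (hgood Q hQ') p he
        _ ≤ ∑ P ∈ goodTuples K S Z x y (k + 1), p ^ (k + 2) * (M * κ) := by
            refine sum_le_sum fun P hP => mul_le_mul_of_nonneg_left ?_ (by positivity)
            exact sum_overlap_le hd hK hxy hxS hyS hSZ hp (by rw [Fintype.card_fin]; exact hD) hS
              hLD (by rw [Fintype.card_fin]; exact hNL) (by rw [Fintype.card_fin]; exact hkN) hDs hP
        _ = (p ^ (k + 1 + 1) * #(goodTuples K S Z x y (k + 1))) * (M * κ) := by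
            rw [sum_const, nsmul_eq_mul]; ring
        _ ≤ M * (M * κ) := mul_le_mul_of_nonneg_right hsum (by positivity)
        _ = κ * M ^ 2 := by ring)
  have h1 : ∑ Q ∈ goodTuples K S Z x y (k + 1), ∏ e ∈ pathEdges Q, edgeProb K p e
      = p ^ (k + 2) * #(goodTuples K S Z x y (k + 1)) := by
    rw [mul_comm, ← nsmul_eq_mul, ← sum_const]
    refine sum_congr rfl fun Q hQ => ?_
    rw [prod_congr rfl (g := fun _ => p) fun e he => edgeProb_pathEdges (hgood Q hQ) p he,
      prod_const, (hgood Q hQ).card_pathEdges]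
  have h2 : (t * M) ^ 2 / (2 * (κ * M ^ 2)) = t ^ 2 / (2 * κ) := by
    field_simp
  rw [h1, h2] at hJ
  exact hJ

lemma disjoint_pathEdges_star {r : ℕ} {Q : Fin n × Fin n × Fin n × (Fin r → Fin n × Fin n)}
    (h : IsPathTuple K Z x y Q.1 Q.2.1 Q.2.2.1 Q.2.2.2) :
    Disjoint (pathEdges Q) ({e | x ∈ e} : Finset (Sym2 (Fin n))) := by
  rw [disjoint_left]
  intro e he hx
  obtain ⟨i, _, rfl⟩ := mem_image.1 he
  rcases Sym2.mem_iff.1 (mem_filter.1 hx).2 with h1 | h1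
  · exact (h.src_ne i).1 h1.symm
  · exact (h.tgt_ne i).1 h1.symm

lemma expect_altPathCount_lt_le (hd : 0 < d) (hK : ∀ v, #{u | K.Adj v u} = d)
    (hxy : x ≠ y) (hp : 0 < p) (hp1 : p ≤ 1) (hD : D = (n : ℝ) * d * p) {s : ℕ} (hs : 1 ≤ s)
    (hLD : 2 * (2 * (k + 2) : ℝ) ≤ D) (hNL : (n : ℝ) * (2 * (k + 2)) ^ k ≤ D ^ k)
    (hkN : 4 * (k + 1) * d * (2 * (k + 2)) ≤ (n : ℝ)) (hDs : 4 * d ≤ D * s) {t τ : ℝ}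
    (ht : 0 ≤ t)
    (hτ : ∀ S : Finset (Fin n), #S = s → τ ≤ p ^ (k + 2) * #(goodTuples K S Z x y (k + 1))
      - t * (p * d * (D ^ (k + 1) * (d * s)))) :
    expect (edgeProb K p) (fun ω => if s ≤ #(nbrs ω x \ (Z ∪ {y})) ∧
        (altPathCount (SimpleGraph.fromEdgeSet (ω : Set (Sym2 (Fin n)))) K (2 * (k + 3)) x y Z : ℝ)
          < τ then 1 else 0)
      ≤ Real.exp (-(t ^ 2 / (2 * (21 / D + 8 * d / (D * s))))) := by
  set R : Finset (Sym2 (Fin n)) := {e | x ∈ e} with hR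
  set B : ℝ := Real.exp (-(t ^ 2 / (2 * (21 / D + 8 * d / (D * s))))) with hB
  have h0 := fun e => edgeProb_nonneg (K := K) hp.le e
  have h1 := fun e => edgeProb_le_one (K := K) hp1 e
  have hsub : ∀ N : Finset (Fin n), ∃ S, s ≤ #(N \ (Z ∪ {y})) → S ⊆ N \ (Z ∪ {y}) ∧ #S = s := by
    intro N
    by_cases h : s ≤ #(N \ (Z ∪ {y}))
    · obtain ⟨S, hS⟩ := exists_subset_card_eq h
      exact ⟨S, fun _ => hS⟩
    · exact ⟨∅, fun h' => absurd h' h⟩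
  choose S hS using hsub
  set g : Finset (Fin n) → Finset (Sym2 (Fin n)) → ℝ := fun N ω =>
    if (∑ Q ∈ goodTuples K (S N) Z x y (k + 1), if pathEdges Q ⊆ ω then (1 : ℝ) else 0)
      ≤ p ^ (k + 2) * #(goodTuples K (S N) Z x y (k + 1))
        - t * (p * d * (D ^ (k + 1) * (d * s))) then 1 else 0 with hg
  have hnbrs : ∀ ω, nbrs (ω ∩ R) x = nbrs ω x := by
    intro ω
    ext v
    simp [nbrs, hR]
  have hSN : ∀ N, x ∉ N → s ≤ #(N \ (Z ∪ {y})) →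
      x ∉ S N ∧ y ∉ S N ∧ Disjoint (S N) Z ∧ #(S N) = s := by
    intro N hxN hN
    obtain ⟨h2, h3⟩ := hS N hN
    refine ⟨fun h => hxN (mem_sdiff.1 (h2 h)).1, fun h => ?_, ?_, h3⟩
    · have := (mem_sdiff.1 (h2 h)).2
      simp at this
    · rw [disjoint_left]
      intro v hv hvZ
      exact (mem_sdiff.1 (h2 hv)).2 (mem_union_left _ hvZ)
  set T : Finset (Finset (Fin n)) := {N | x ∉ N ∧ s ≤ #(N \ (Z ∪ {y}))} with hT
  have hgR : ∀ N ∈ T, ∀ ω, g N (ω \ R) = g N ω := by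
    intro N hN ω
    obtain ⟨hxN, hN'⟩ := (mem_filter.1 hN).2
    obtain ⟨h2, h3, h4, h5⟩ := hSN N hxN hN'
    have hsum : ∑ Q ∈ goodTuples K (S N) Z x y (k + 1),
        (if pathEdges Q ⊆ ω \ R then (1 : ℝ) else 0)
        = ∑ Q ∈ goodTuples K (S N) Z x y (k + 1), if pathEdges Q ⊆ ω then (1 : ℝ) else 0 := by
      refine sum_congr rfl fun Q hQ => ?_
      have := disjoint_pathEdges_star
        (isPathTuple_of_mem_goodTuples (Nat.succ_ne_zero k) hxy h2 h3 h4 hQ)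
      have hiff : pathEdges Q ⊆ ω \ R ↔ pathEdges Q ⊆ ω := by
        rw [subset_sdiff]
        exact and_iff_left this
      simp only [hiff]
    simp only [hg]
    rw [hsum]
  have hgle : ∀ N ∈ T, expect (edgeProb K p) (g N) ≤ B := by
    intro N hN
    obtain ⟨hxN, hN'⟩ := (mem_filter.1 hN).2
    obtain ⟨h2, h3, h4, h5⟩ := hSN N hxN hN'
    have := expect_card_tuples_le (k := k) hd hK hxy h2 h3 h4 hp hp1 hD (by omega) hLD hNL hkN
      (by rw [h5]; exact hDs) ht
    rw [h5] at this
    exact this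
  have hpt : ∀ ω, (if s ≤ #(nbrs ω x \ (Z ∪ {y})) ∧
        (altPathCount (SimpleGraph.fromEdgeSet (ω : Set (Sym2 (Fin n)))) K (2 * (k + 3)) x y Z : ℝ)
          < τ then (1 : ℝ) else 0)
      ≤ ∑ N ∈ T, (if nbrs (ω ∩ R) x = N then 1 else 0) * g N (ω \ R) := by
    intro ω
    have hnn : ∀ N ∈ T, (0 : ℝ) ≤ (if nbrs (ω ∩ R) x = N then 1 else 0) * g N (ω \ R) := by
      intro N _
      simp only [hg]
      split_ifs <;> norm_num
    split_ifs with h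
    · have hxN : x ∉ nbrs ω x := by simp [nbrs]
      have hN : nbrs ω x ∈ T := mem_filter.2 ⟨mem_univ _, hxN, h.1⟩
      obtain ⟨h2, h3, h4, h5⟩ := hSN _ hxN h.1
      refine le_trans ?_ (single_le_sum hnn hN)
      rw [hgR _ hN, hnbrs, if_pos rfl, one_mul]
      simp only [hg]
      rw [if_pos]
      refine le_trans ?_ (h.2.le.trans (hτ _ h5))
      rw [← sum_filter, sum_const, nsmul_eq_mul, mul_one]
      refine Nat.cast_le.2
        (card_tuples_le_altPathCount (G := SimpleGraph.fromEdgeSet (ω : Set (Sym2 (Fin n))))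
          (r := k + 1) (Nat.succ_ne_zero k) hxy h2 h3 h4 (fun v hv => ?_) fun Q hQ => ?_)
      · have := (mem_filter.1 (mem_sdiff.1 ((hS _ h.1).1 hv)).1).2
        rw [SimpleGraph.fromEdgeSet_adj]
        exact ⟨this.1, this.2.symm⟩
      · obtain ⟨hQ1, hQ2⟩ := mem_filter.1 hQ
        refine ⟨hQ1, fun e he => ?_⟩
        have hpt := isPathTuple_of_mem_goodTuples (Nat.succ_ne_zero k) hxy h2 h3 h4 hQ1
        obtain ⟨i, _, rfl⟩ := mem_image.1 he
        rw [SimpleGraph.mem_edgeSet, SimpleGraph.fromEdgeSet_adj]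
        exact ⟨hQ2 he, hpt.src_ne_tgt i i⟩
    · exact sum_nonneg hnn
  calc _ ≤ expect (edgeProb K p) (fun ω =>
        ∑ N ∈ T, (if nbrs (ω ∩ R) x = N then 1 else 0) * g N (ω \ R)) := expect_mono h0 h1 hpt
    _ = ∑ N ∈ T, expect (edgeProb K p) (fun ω => if nbrs ω x = N then 1 else 0)
          * expect (edgeProb K p) (g N) := by
        rw [expect_sum]
        refine sum_congr rfl fun N hN => ?_
        rw [expect_mul_of_disjoint (edgeProb K p) R (fun ω => if nbrs ω x = N then 1 else 0) (g N)]
        simp only [hgR N hN, hnbrs]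
    _ ≤ ∑ N ∈ T, expect (edgeProb K p) (fun ω => if nbrs ω x = N then 1 else 0) * B := by
        refine sum_le_sum fun N hN => mul_le_mul_of_nonneg_left (hgle N hN) ?_
        exact expect_nonneg h0 h1 fun ω => by split_ifs <;> norm_num
    _ ≤ 1 * B := by
        rw [← sum_mul, ← expect_sum]
        refine mul_le_mul_of_nonneg_right ?_ (Real.exp_pos _).le
        refine (expect_mono h0 h1 (g := fun _ => 1) fun ω => ?_).trans_eq (expect_const _ 1)
        rw [sum_ite_eq]
        split_ifs <;> norm_num
    _ = B := one_mul B

end TailBounds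

section ParameterRange

open Finset

/-- The numerical conditions on the parameters under which the path counts are controlled. -/
structure ParamRange (n d : ℕ) (δ lam p ε B : ℝ) : Prop where
  eps_pos : 0 < ε
  eps_le : ε ≤ 1
  d_pos : 0 < d
  p_pos : 0 < p
  p_le : p ≤ 1
  delta_eq : δ = ((n : ℝ) - 1 - d) * p
  lam_pos : 0 < lam
  le_B : 10 ≤ B
  B_pow : B ^ 10 ≤ n
  d_le : d ≤ B
  delta_le : δ ≤ B
  log_le : 100 * Real.log n ≤ B
  one_le_lam_mul : 1 ≤ lam * B
  le_log : 4 ≤ Real.log n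
  log_le_d : 10 ^ 6 * Real.log n ≤ ε * d
  d_le_delta : 2 * ε * d ≤ δ
  log_le_lam : 2 * Real.log n ≤ lam ^ 4 * δ

/-- The main term `p^(k+2) * #tuples`, bounded below up to relative errors. -/
lemma le_main_term {k : ℕ} {N d p ζ s z c G lam ρ : ℝ} (hN : 0 < N) (hd : 0 < d) (hp : 0 < p)
    (hs : 0 < s) (hζ : 0 ≤ ζ) (hζd : ζ ≤ d) (hz : 0 ≤ z) (hzs : z ≤ s) (hc : c = N * d * (1 - ρ))
    (hρ : 0 ≤ ρ) (hρ1 : ρ ≤ 1) (hρk : (k + 1) * ρ ≤ lam)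
    (hG : (d - ζ) * ((s - z) * d) * c ^ (k + 1) ≤ G) :
    p * d * ((N * d * p) ^ (k + 1) * (d * s)) * (1 - ζ / d - z / s - lam) ≤ p ^ (k + 2) * G := by
  have hbern : 1 - lam ≤ (1 - ρ) ^ (k + 1) := by
    have := one_add_mul_le_pow (a := -ρ) (by linarith) (k + 1)
    push_cast at this
    rw [← sub_eq_add_neg] at this
    linarith
  have h1 : 0 ≤ 1 - ζ / d := by rw [sub_nonneg, div_le_one hd]; exact hζd
  have h2 : 0 ≤ 1 - z / s := by rw [sub_nonneg, div_le_one hs]; exact hzs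
  have ha : 0 ≤ ζ / d := by positivity
  have hb : 0 ≤ z / s := by positivity
  have hlam0 : 0 ≤ lam := le_trans (by positivity) hρk
  have h3 : 1 - ζ / d - z / s - lam ≤ (1 - ζ / d) * (1 - z / s) * (1 - ρ) ^ (k + 1) := by
    have h4 : (1 - ζ / d) * (1 - z / s) * (1 - lam)
        ≤ (1 - ζ / d) * (1 - z / s) * (1 - ρ) ^ (k + 1) :=
      mul_le_mul_of_nonneg_left hbern (mul_nonneg h1 h2)
    have h5 : (1 - ζ / d) * (1 - z / s) ≤ 1 := by nlinarith
    nlinarith [mul_nonneg ha hb, mul_nonneg hlam0 (sub_nonneg.2 h5)]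
  calc _ ≤ p * d * ((N * d * p) ^ (k + 1) * (d * s))
        * ((1 - ζ / d) * (1 - z / s) * (1 - ρ) ^ (k + 1)) :=
        mul_le_mul_of_nonneg_left h3 (by positivity)
    _ = p ^ (k + 2) * ((d - ζ) * ((s - z) * d) * c ^ (k + 1)) := by
        rw [hc]
        simp only [mul_pow, pow_succ]
        field_simp
    _ ≤ _ := mul_le_mul_of_nonneg_left hG (by positivity)

lemma target_le_main_term {k : ℕ} {N d p s δ lam a b : ℝ} (hN : 0 < N) (hd : 0 < d) (hδ : 0 < δ)
    (hpδ : δ ≤ N * p) (hs : (1 - 22 * lam) * δ ≤ s) (ha : 0 ≤ a) (hb : b ≤ 41 * lam) (hb0 : 0 ≤ b)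
    (hlam : 0 ≤ lam) (hpos : 0 < 1 - 100 * lam - a) :
    (1 - 100 * lam - a) * d ^ (k + 3) * δ ^ (k + 3) / N
      ≤ p * d * ((N * d * p) ^ (k + 1) * (d * s)) * (1 - a - b - lam)
        - lam * (p * d * ((N * d * p) ^ (k + 1) * (d * s))) := by
  have h1 : 0 ≤ 1 - a - b - 2 * lam := by linarith
  have h2 : 0 ≤ 1 - 22 * lam := by linarith
  have hpow : δ ^ (k + 2) ≤ (N * p) ^ (k + 2) := pow_le_pow_left₀ hδ.le hpδ _
  have hM : (1 - 22 * lam) * (d ^ (k + 3) * δ ^ (k + 3) / N)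
      ≤ p * d * ((N * d * p) ^ (k + 1) * (d * s)) := by
    have : p * d * ((N * d * p) ^ (k + 1) * (d * s)) = d ^ (k + 3) * (N * p) ^ (k + 2) / N * s := by
      simp only [mul_pow, pow_succ]
      field_simp
    rw [this]
    calc (1 - 22 * lam) * (d ^ (k + 3) * δ ^ (k + 3) / N)
        = d ^ (k + 3) * δ ^ (k + 2) / N * ((1 - 22 * lam) * δ) := by ring
      _ ≤ d ^ (k + 3) * (N * p) ^ (k + 2) / N * s := by
          have := mul_nonneg h2 hδ.le
          have := hδ.le.trans hpδ
          gcongr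
  calc _ = (1 - 100 * lam - a) * (d ^ (k + 3) * δ ^ (k + 3) / N) := by ring
    _ ≤ (1 - a - b - 2 * lam) * ((1 - 22 * lam) * (d ^ (k + 3) * δ ^ (k + 3) / N)) := by
        rw [← mul_assoc]
        refine mul_le_mul_of_nonneg_right ?_ (by positivity)
        nlinarith [mul_nonneg hlam ha, mul_nonneg hlam hb0]
    _ ≤ (1 - a - b - 2 * lam) * (p * d * ((N * d * p) ^ (k + 1) * (d * s))) :=
        mul_le_mul_of_nonneg_left hM h1
    _ = _ := by ring

namespace ParamRange

variable {d : ℕ} {δ lam p ε B : ℝ}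

lemma n_pos (h : ParamRange n d δ lam p ε B) : 0 < (n : ℝ) :=
  lt_of_lt_of_le (by have := h.le_B; positivity) h.B_pow

lemma d_pos' (h : ParamRange n d δ lam p ε B) : 0 < (d : ℝ) := Nat.cast_pos.2 h.d_pos

lemma delta_pos (h : ParamRange n d δ lam p ε B) : 0 < δ :=
  lt_of_lt_of_le (by have := h.eps_pos; have := h.d_pos'; positivity) h.d_le_delta

lemma delta_le_mul (h : ParamRange n d δ lam p ε B) : δ ≤ n * p := by
  rw [h.delta_eq]
  have := h.d_pos'
  exact mul_le_mul_of_nonneg_right (by linarith) h.p_pos.le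

lemma mul_delta_le (h : ParamRange n d δ lam p ε B) : d * δ ≤ n * d * p := by
  have := mul_le_mul_of_nonneg_left h.delta_le_mul h.d_pos'.le
  linarith

lemma log_le_delta (h : ParamRange n d δ lam p ε B) : 10 ^ 6 * Real.log n ≤ δ := by
  have h1 := h.log_le_d
  have h2 := h.d_le_delta
  have h3 := mul_pos h.eps_pos h.d_pos'
  linarith

/-- The variance parameter is dominated by the expected number of paths of length two. -/
lemma sq_log_le (h : ParamRange n d δ lam p ε B) :
    5800 * Real.log n ^ 2 ≤ ε * (lam ^ 2 * (n * d * p)) := by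
  have hL : 0 < Real.log n := by linarith [h.le_log]
  have hε := h.eps_pos
  have hd := h.d_pos'
  have hδ := h.delta_pos
  refine le_trans ?_ (mul_le_mul_of_nonneg_left
    (mul_le_mul_of_nonneg_left h.mul_delta_le (sq_nonneg lam)) hε.le)
  refine abs_le_of_sq_le_sq' ?_ (by positivity) |>.2
  have h1 : (10 ^ 6 * Real.log n) ^ 2 ≤ (ε * d) ^ 2 :=
    pow_le_pow_left₀ (by positivity) h.log_le_d 2
  calc (5800 * Real.log n ^ 2) ^ 2
      ≤ (10 ^ 6 * Real.log n) ^ 2 * (2 * Real.log n * (10 ^ 6 * Real.log n)) := by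
        nlinarith [pow_pos hL 4]
    _ ≤ (ε * d) ^ 2 * (lam ^ 4 * δ * δ) :=
        mul_le_mul h1 (mul_le_mul h.log_le_lam h.log_le_delta (by positivity) (by positivity))
          (by positivity) (by positivity)
    _ = (ε * (lam ^ 2 * (d * δ))) ^ 2 := by ring

lemma sq_log_le' (h : ParamRange n d δ lam p ε B) :
    10 ^ 6 * Real.log n ^ 2 ≤ n * d * p := by
  have hL : 0 < Real.log n := by linarith [h.le_log]
  refine le_trans ?_ h.mul_delta_le
  have h2 : 10 ^ 6 * Real.log n ≤ d := h.log_le_d.trans (mul_le_of_le_one_left h.d_pos'.le h.eps_le)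
  calc 10 ^ 6 * Real.log n ^ 2 ≤ (10 ^ 6 * Real.log n) * (10 ^ 6 * Real.log n) := by
        nlinarith [pow_pos hL 2]
    _ ≤ d * δ := mul_le_mul h2 h.log_le_delta (by positivity) h.d_pos'.le

lemma expect_card_nbrs_le_log (h : ParamRange n d δ lam p ε B) {K : SimpleGraph (Fin n)}
    (hK : ∀ v, #{u | K.Adj v u} = d) (x : Fin n) :
    expect (edgeProb K p) (fun ω => if (#(nbrs ω x) : ℝ) ≤ (1 - lam) * δ then 1 else 0)
      ≤ Real.exp (-(100 * Real.log n)) := by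
  have hδ := h.delta_pos
  have hL : 0 < Real.log n := by linarith [h.le_log]
  have := expect_card_nbrs_le hK x (a := lam * δ) h.p_pos h.p_le
    (mul_nonneg h.lam_pos.le hδ.le) h.delta_eq hδ
  rw [show (1 - lam) * δ = δ - lam * δ by ring]
  refine this.trans (Real.exp_le_exp.2 (neg_le_neg ?_))
  rw [le_div_iff₀ (by positivity)]
  have h1 : 200 * Real.log n ≤ lam ^ 2 * δ := by
    refine abs_le_of_sq_le_sq' ?_ (by have := h.lam_pos; positivity) |>.2
    calc (200 * Real.log n) ^ 2 ≤ 2 * Real.log n * (10 ^ 6 * Real.log n) := by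
          nlinarith [pow_pos hL 2]
      _ ≤ lam ^ 4 * δ * δ := mul_le_mul h.log_le_lam h.log_le_delta (by positivity) (by positivity)
      _ = (lam ^ 2 * δ) ^ 2 := by ring
  nlinarith

end ParamRange

end ParameterRange

section PathCounts

open Finset

namespace ParamRange

variable {d : ℕ} {δ lam p ε B : ℝ} {K : SimpleGraph (Fin n)}

/-- The relative error caused by forbidding edges is negligible. -/
lemma forbidden_le (h : ParamRange n d δ lam p ε B) {z s κ : ℝ} (hz : z ≤ B) (hs0 : 0 ≤ s)
    (hs : s ≤ 2 * B) (hκ : κ ≤ B) (hκ0 : 0 ≤ κ) :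
    κ * ((2 * d * (z + 5 + 3 * d + d * s) + κ * (4 * d + d * d)) / (n * d)) ≤ lam := by
  have hN := h.n_pos
  have hd := h.d_pos'
  have hB := h.le_B
  have h1 : 1 ≤ B := by linarith
  have hdB := h.d_le
  have hds : d * s ≤ B * (2 * B) := mul_le_mul hdB hs hs0 (by linarith)
  have hκd : κ * (4 + d) ≤ B * (4 + B) := mul_le_mul hκ (by linarith) (by linarith) (by linarith)
  have hnum : (2 * d * (z + 5 + 3 * d + d * s) + κ * (4 * d + d * d)) / (n * d)
      = (2 * (z + 5 + 3 * d + d * s) + κ * (4 + d)) / n := by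
    field_simp
  have hBB : B ≤ B ^ 2 := by nlinarith
  have h2 : 2 * (z + 5 + 3 * d + d * s) + κ * (4 + d) ≤ 10 * B ^ 2 := by nlinarith
  have h3 : κ * ((2 * (z + 5 + 3 * d + d * s) + κ * (4 + d)) / n) ≤ B * (10 * B ^ 2 / n) := by
    refine (mul_le_mul_of_nonneg_left (div_le_div_of_nonneg_right h2 hN.le) hκ0).trans ?_
    exact mul_le_mul_of_nonneg_right hκ (by positivity)
  rw [hnum]
  refine h3.trans ?_
  have h4 : B * (10 * B ^ 2) ≤ lam * n := by
    calc B * (10 * B ^ 2) ≤ 1 * B ^ 4 := by nlinarith [pow_pos (lt_of_lt_of_le one_pos h1) 3]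
      _ ≤ lam * B * B ^ 9 := by
          refine mul_le_mul h.one_le_lam_mul (pow_le_pow_right₀ h1 (by norm_num)) (by positivity) ?_
          have := h.lam_pos
          positivity
      _ = lam * B ^ 10 := by ring
      _ ≤ lam * n := mul_le_mul_of_nonneg_left h.B_pow h.lam_pos.le
  rw [← mul_div_assoc, div_le_iff₀ hN]
  exact h4

lemma target_le_goodTuples (h : ParamRange n d δ lam p ε B) (hK : ∀ v, #{u | K.Adj v u} = d)
    {x y : Fin n} {S Z : Finset (Fin n)} {k : ℕ} (hZ : (#Z : ℝ) ≤ 40 * Real.log n)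
    (hk : (k : ℝ) + 3 ≤ 10 * Real.log n) (hS : (1 - 22 * lam) * δ ≤ #S) (hS' : (#S : ℝ) ≤ 2 * δ)
    (hpos : 0 < 1 - 100 * lam - (#((Z ∪ {x}) ∩ univ.filter (K.Adj y)) : ℝ) / d) :
    (1 - 100 * lam - (#((Z ∪ {x}) ∩ univ.filter (K.Adj y)) : ℝ) / d) * d ^ (k + 3) * δ ^ (k + 3) / n
      ≤ p ^ (k + 2) * #(goodTuples K S Z x y (k + 1))
        - lam * (p * d * ((n * d * p) ^ (k + 1) * (d * #S))) := by
  have hN := h.n_pos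
  have hd := h.d_pos'
  have hδ := h.delta_pos
  have hlam := h.lam_pos
  have hL := h.le_log
  have hlogB := h.log_le
  have hlogδ := h.log_le_delta
  set ζ : ℝ := ((#((Z ∪ {x}) ∩ univ.filter (K.Adj y)) : ℕ) : ℝ) with hζ
  have hζd : ζ ≤ d := by
    rw [hζ, ← hK y]
    exact Nat.cast_le.2 (card_le_card inter_subset_right)
  have hζ0 : 0 ≤ ζ / d := by positivity
  have hlam1 : lam < 1 / 100 := by linarith
  have hSδ : δ / 2 ≤ #S := by nlinarith
  have hS0 : 0 < (#S : ℝ) := by linarith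
  have hb : ((#Z : ℝ) + 4) / #S ≤ 41 * lam := by
    rw [div_le_iff₀ hS0]
    have h3 : lam ^ 4 * δ ≤ lam * δ := by
      refine mul_le_mul_of_nonneg_right ?_ hδ.le
      have : lam ^ 3 ≤ 1 := pow_le_one₀ hlam.le (by linarith)
      nlinarith
    nlinarith [h.log_le_lam]
  have hzs : (#Z : ℝ) + 4 ≤ #S := by
    rw [div_le_iff₀ hS0] at hb
    nlinarith
  have hfor := h.forbidden_le (z := #Z) (s := #S) (κ := (k : ℝ) + 1) (by linarith) hS0.le
    (by linarith [h.delta_le]) (by linarith) (by positivity)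
  set ρ : ℝ := (2 * d * (#Z + 5 + 3 * d + d * #S) + ((k : ℝ) + 1) * (4 * d + d * d)) / (n * d)
    with hρ
  have hρ0 : 0 ≤ ρ := by positivity
  have hρ1 : ρ ≤ 1 := by
    have : (0 : ℝ) ≤ k * ρ := by positivity
    linarith
  have hc : (n : ℝ) * d * (1 - ρ) = n * d - 2 * d * (#Z + 5 + 3 * d + d * #S)
      - ((k + 1 : ℕ) : ℝ) * (4 * d + d * d) := by
    have : (n : ℝ) * d * ρ
        = 2 * d * (#Z + 5 + 3 * d + d * #S) + ((k : ℝ) + 1) * (4 * d + d * d) := by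
      rw [hρ]
      field_simp
    push_cast
    linarith
  have hG := le_card_goodTuples hK S Z x y (k + 1) (c := (n : ℝ) * d * (1 - ρ))
    (mul_nonneg (by positivity) (by linarith)) (by rw [Fintype.card_fin]; exact hc.le) hzs
  rw [← hζ, sub_sub] at hG
  have h1 := le_main_term hN hd h.p_pos hS0 (by positivity) hζd (by positivity) hzs rfl hρ0 hρ1
    hfor hG
  have h2 := target_le_main_term (k := k) hN hd hδ h.delta_le_mul hS hζ0 hb (by positivity)
    hlam.le hpos
  linarith

lemma le_exponent (h : ParamRange n d δ lam p ε B) {s : ℝ} (hsd : ε * d ≤ s) :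
    100 * Real.log n ^ 2
      ≤ lam ^ 2 / (2 * (21 / (n * d * p) + 8 * d / (n * d * p * s))) := by
  have hε := h.eps_pos
  have hd := h.d_pos'
  have hs0 : 0 < s := lt_of_lt_of_le (by positivity) hsd
  have h6 := h.sq_log_le
  have hD0 : 0 < (n : ℝ) * d * p := mul_pos (mul_pos h.n_pos hd) h.p_pos
  set D : ℝ := n * d * p
  have h2 : 21 / D + 8 * d / (D * s) ≤ 29 / (ε * D) := by
    have h3 : 21 / D ≤ 21 / (ε * D) := by
      refine div_le_div_of_nonneg_left (by norm_num) (by positivity) ?_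
      exact mul_le_of_le_one_left hD0.le h.eps_le
    have h4 : 8 * d / (D * s) ≤ 8 / (ε * D) := by
      rw [div_le_div_iff₀ (by positivity) (by positivity)]
      calc 8 * (d : ℝ) * (ε * D) = 8 * (D * (ε * d)) := by ring
        _ ≤ 8 * (D * s) := by gcongr
    have h5 : 29 / (ε * D) = 21 / (ε * D) + 8 / (ε * D) := by ring
    linarith
  calc 100 * Real.log n ^ 2 ≤ lam ^ 2 / (2 * (29 / (ε * D))) := by
        have : lam ^ 2 / (2 * (29 / (ε * D))) = ε * (lam ^ 2 * D) / 58 := by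
          field_simp
          ring
        rw [this]
        linarith
    _ ≤ lam ^ 2 / (2 * (21 / D + 8 * d / (D * s))) := by
        refine div_le_div_of_nonneg_left (sq_nonneg _) (by positivity) ?_
        linarith

lemma pow_le_pow_mul (h : ParamRange n d δ lam p ε B) {k : ℕ}
    (hk : (k : ℝ) + 3 ≤ 10 * Real.log n) (hkn : (n : ℝ) ^ 2 ≤ (d * δ) ^ k) :
    2 * (2 * ((k : ℝ) + 2)) ≤ n * d * p ∧
      (n : ℝ) * (2 * (k + 2)) ^ k ≤ (n * d * p) ^ k := by
  have hd := h.d_pos'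
  have hδ := h.delta_pos
  have hL := h.le_log
  have hD := h.sq_log_le'
  have hN := h.n_pos
  have hp := h.p_pos
  have hle := h.mul_delta_le
  set D : ℝ := n * d * p with hDdef
  have hD0 : 0 < D := by positivity
  have hk0 : (0 : ℝ) ≤ k := k.cast_nonneg
  have hLk : 2 * ((k : ℝ) + 2) ≤ 20 * Real.log n := by linarith
  have hLD : (2 * ((k : ℝ) + 2)) ^ 2 ≤ D := by
    refine le_trans (pow_le_pow_left₀ (by positivity) hLk 2) (le_trans ?_ hD)
    linarith [sq_nonneg (Real.log n), mul_pow 20 (Real.log n) 2]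
  refine ⟨by nlinarith, abs_le_of_sq_le_sq' ?_ (by positivity) |>.2⟩
  calc ((n : ℝ) * (2 * (k + 2)) ^ k) ^ 2 = n ^ 2 * ((2 * (k + 2)) ^ 2) ^ k := by
        rw [mul_pow, ← pow_mul, ← pow_mul, mul_comm k 2]
    _ ≤ (d * δ) ^ k * D ^ k := by
        refine mul_le_mul hkn (pow_le_pow_left₀ (by positivity) hLD k) (by positivity)
          (by positivity)
    _ ≤ D ^ k * D ^ k := by
        refine mul_le_mul_of_nonneg_right ?_ (by positivity)
        exact pow_le_pow_left₀ (by positivity) hle k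
    _ = (D ^ k) ^ 2 := by ring

lemma blocked_le (h : ParamRange n d δ lam p ε B) {k : ℕ}
    (hk : (k : ℝ) + 3 ≤ 10 * Real.log n) : 4 * ((k : ℝ) + 1) * d * (2 * (k + 2)) ≤ n := by
  have hB := h.le_B
  have hkB : (k : ℝ) + 3 ≤ B := by linarith [h.le_log, h.log_le]
  have hdB := h.d_le
  refine le_trans ?_ h.B_pow
  calc 4 * ((k : ℝ) + 1) * d * (2 * (k + 2)) ≤ 4 * B * B * (2 * B) := by gcongr <;> linarith
    _ = 8 * B ^ 3 := by ring
    _ ≤ B * B ^ 3 := mul_le_mul_of_nonneg_right (by linarith) (by positivity)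
    _ = B ^ 4 := by ring
    _ ≤ B ^ 10 := pow_le_pow_right₀ (by linarith) (by norm_num)

/-- For a fixed choice of `x`, `y`, `Z` and length, few alternating paths are unlikely. -/
lemma expect_few_paths_le (h : ParamRange n d δ lam p ε B) (hK : ∀ v, #{u | K.Adj v u} = d)
    {x y : Fin n} (hxy : x ≠ y) {Z : Finset (Fin n)} {k : ℕ} (hZ : (#Z : ℝ) ≤ 40 * Real.log n)
    (hk : (k : ℝ) + 3 ≤ 10 * Real.log n) (hkn : (n : ℝ) ^ 2 ≤ (d * δ) ^ k) :
    expect (edgeProb K p) (fun ω => if (1 - lam) * δ < #(nbrs ω x) ∧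
        (altPathCount (SimpleGraph.fromEdgeSet (ω : Set (Sym2 (Fin n)))) K (2 * (k + 3)) x y Z : ℝ)
          < (1 - 100 * lam - (#((Z ∪ {x}) ∩ univ.filter (K.Adj y)) : ℝ) / d)
            * d ^ (k + 3) * δ ^ (k + 3) / n then 1 else 0)
      ≤ Real.exp (-(100 * Real.log n ^ 2)) := by
  have hN := h.n_pos
  have hd := h.d_pos'
  have hδ := h.delta_pos
  have hlam := h.lam_pos
  have hL := h.le_log
  have hlogB := h.log_le
  have hlogδ := h.log_le_delta
  have hp := h.p_pos
  have hε := h.eps_pos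
  have h0 := fun e => edgeProb_nonneg (K := K) h.p_pos.le e
  have h1 := fun e => edgeProb_le_one (K := K) h.p_le e
  by_cases hpos : 0 < 1 - 100 * lam - (#((Z ∪ {x}) ∩ univ.filter (K.Adj y)) : ℝ) / d
  swap
  · refine le_trans (expect_mono h0 h1 (g := fun _ => 0) fun ω => ?_) ?_
    · rw [if_neg]
      rintro ⟨-, h2⟩
      refine absurd h2 (not_lt.2 (le_trans ?_ (Nat.cast_nonneg _)))
      rw [mul_assoc, mul_div_assoc]
      exact mul_nonpos_of_nonpos_of_nonneg (not_lt.1 hpos) (by positivity)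
    · rw [expect_const]
      exact (Real.exp_pos _).le
  have hζ0 : 0 ≤ (#((Z ∪ {x}) ∩ univ.filter (K.Adj y)) : ℝ) / d := by positivity
  have hlam1 : lam < 1 / 100 := by linarith
  set s := ⌈(1 - 22 * lam) * δ⌉₊ with hs
  have hs1 : (1 - 22 * lam) * δ ≤ s := Nat.le_ceil _
  have hs2 : (s : ℝ) < (1 - 22 * lam) * δ + 1 := Nat.ceil_lt_add_one (by nlinarith)
  have hs3 : (s : ℝ) ≤ 2 * δ := by nlinarith
  have hs4 : δ / 2 ≤ s := by nlinarith
  have hs0 : 0 < (s : ℝ) := by linarith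
  have hsN : 1 ≤ s := Nat.cast_pos.1 hs0
  have hlamδ : lam ^ 4 * δ ≤ lam * δ := by
    refine mul_le_mul_of_nonneg_right ?_ hδ.le
    have : lam ^ 3 ≤ 1 := pow_le_one₀ hlam.le (by linarith)
    nlinarith
  have hmono : ∀ ω, (if (1 - lam) * δ < #(nbrs ω x) ∧
        (altPathCount (SimpleGraph.fromEdgeSet (ω : Set (Sym2 (Fin n)))) K (2 * (k + 3)) x y Z : ℝ)
          < (1 - 100 * lam - (#((Z ∪ {x}) ∩ univ.filter (K.Adj y)) : ℝ) / d)
            * d ^ (k + 3) * δ ^ (k + 3) / n then (1 : ℝ) else 0)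
      ≤ if s ≤ #(nbrs ω x \ (Z ∪ {y})) ∧
        (altPathCount (SimpleGraph.fromEdgeSet (ω : Set (Sym2 (Fin n)))) K (2 * (k + 3)) x y Z : ℝ)
          < (1 - 100 * lam - (#((Z ∪ {x}) ∩ univ.filter (K.Adj y)) : ℝ) / d)
            * d ^ (k + 3) * δ ^ (k + 3) / n then 1 else 0 := by
    intro ω
    by_cases hω : (1 - lam) * δ < #(nbrs ω x) ∧
        (altPathCount (SimpleGraph.fromEdgeSet (ω : Set (Sym2 (Fin n)))) K (2 * (k + 3)) x y Z : ℝ)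
          < (1 - 100 * lam - (#((Z ∪ {x}) ∩ univ.filter (K.Adj y)) : ℝ) / d)
            * d ^ (k + 3) * δ ^ (k + 3) / n
    · rw [if_pos hω, if_pos]
      refine ⟨?_, hω.2⟩
      have h2 : #(nbrs ω x) ≤ #(nbrs ω x \ (Z ∪ {y})) + #(Z ∪ {y}) := by
        have := le_card_sdiff (Z ∪ {y}) (nbrs ω x)
        omega
      have h3 : #(Z ∪ {y}) ≤ #Z + 1 := card_union_le _ _
      have h4 : (#(nbrs ω x) : ℝ) ≤ #(nbrs ω x \ (Z ∪ {y})) + (#Z + 1) := by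
        exact_mod_cast h2.trans (by omega)
      have h5 : (s : ℝ) ≤ #(nbrs ω x \ (Z ∪ {y})) := by
        linarith [hω.1, h.log_le_lam]
      exact_mod_cast h5
    · rw [if_neg hω]
      split_ifs <;> norm_num
  refine (expect_mono h0 h1 hmono).trans ?_
  obtain ⟨hLD, hNL⟩ := h.pow_le_pow_mul hk hkn
  have hkN := h.blocked_le hk
  have hεD := h.sq_log_le
  have hD0 : 0 < (n : ℝ) * d * p := by positivity
  have hsd : ε * d ≤ s := by linarith [h.d_le_delta]
  have hDs : 4 * (d : ℝ) ≤ n * d * p * s := by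
    have h2 : lam ^ 2 ≤ 1 := pow_le_one₀ hlam.le (by linarith)
    have h3 : ε * (lam ^ 2 * (n * d * p)) ≤ ε * (n * d * p) :=
      mul_le_mul_of_nonneg_left (mul_le_of_le_one_left hD0.le h2) hε.le
    have h4 : (1 : ℝ) ≤ Real.log n ^ 2 := one_le_pow₀ (by linarith)
    calc 4 * (d : ℝ) ≤ (ε * (n * d * p)) * d := mul_le_mul_of_nonneg_right (by linarith) hd.le
      _ = n * d * p * (ε * d) := by ring
      _ ≤ n * d * p * s := mul_le_mul_of_nonneg_left hsd hD0.le
  refine (expect_altPathCount_lt_le (k := k) (Z := Z) (t := lam) h.d_pos hK hxy h.p_pos h.p_le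
    rfl hsN hLD hNL hkN hDs hlam.le fun S hS => ?_).trans ?_
  · have := h.target_le_goodTuples hK (x := x) (y := y) (S := S) hZ hk (by rw [hS]; exact hs1)
      (by rw [hS]; exact hs3) hpos
    rw [hS] at this
    exact this
  · exact Real.exp_le_exp.2 (neg_le_neg (h.le_exponent hsd))

end ParamRange

end PathCounts

section UnionBound

open Finset

lemma card_small_finsets_le {N : ℕ} (hN : 2 ≤ N) {t : ℝ} (ht : 0 ≤ t) :
    (#(univ.filter fun Z : Finset (Fin N) => (#Z : ℝ) ≤ t) : ℝ)
      ≤ Real.exp ((t + 1) * Real.log N) := by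
  have h1 : (univ.filter fun Z : Finset (Fin N) => (#Z : ℝ) ≤ t)
      ⊆ (range (⌊t⌋₊ + 1)).biUnion fun i => powersetCard i univ := by
    intro Z hZ
    refine mem_biUnion.2 ⟨#Z, mem_range.2 (Nat.lt_succ_of_le (Nat.le_floor (mem_filter.1 hZ).2)), ?_⟩
    exact mem_powersetCard.2 ⟨subset_univ _, rfl⟩
  have h2 : #(univ.filter fun Z : Finset (Fin N) => (#Z : ℝ) ≤ t) ≤ N ^ (⌊t⌋₊ + 1) := by
    refine (card_le_card h1).trans (card_biUnion_le.trans ?_)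
    refine le_trans (sum_le_sum fun i _ => ?_)
      (Nat.geomSum_lt (s := range (⌊t⌋₊ + 1)) hN fun i hi => mem_range.1 hi).le
    rw [card_powersetCard, card_univ, Fintype.card_fin]
    exact Nat.choose_le_pow _ _
  have hN0 : (0 : ℝ) < N := by positivity
  have hlog : 0 ≤ Real.log N := Real.log_natCast_nonneg N
  calc (#(univ.filter fun Z : Finset (Fin N) => (#Z : ℝ) ≤ t) : ℝ) ≤ (N : ℝ) ^ (⌊t⌋₊ + 1) := by
        exact_mod_cast h2
    _ = Real.exp (((⌊t⌋₊ + 1 : ℕ) : ℝ) * Real.log N) := by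
        rw [Real.exp_nat_mul, Real.exp_log hN0]
    _ ≤ Real.exp ((t + 1) * Real.log N) := by
        refine Real.exp_le_exp.2 (mul_le_mul_of_nonneg_right ?_ hlog)
        push_cast
        linarith [Nat.floor_le ht]

/-- The path counts of all admissible lengths are large, for all pairs of endpoints and all small
forbidden sets. -/
def ManyPaths (G K : SimpleGraph (Fin n)) (d ℓ₀ : ℕ) (δ lam : ℝ) : Prop :=
  ∀ x y : Fin n, x ≠ y → ∀ Z : Set (Fin n), (Z.ncard : ℝ) ≤ 40 * Real.log n →
    ∀ ℓ : ℕ, 10 * ℓ₀ ≤ ℓ → (ℓ : ℝ) ≤ 10 * Real.log n →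
      (1 - 100 * lam - (((Z ∪ {x}) ∩ K.neighborSet y).ncard : ℝ) / d) * (d : ℝ) ^ ℓ * δ ^ ℓ / n
        ≤ (altPathCount G K (2 * ℓ) x y Z : ℝ)

namespace ParamRange

variable {d ℓ₀ : ℕ} {δ lam p ε B : ℝ} {K : SimpleGraph (Fin n)}

lemma sq_le_pow (h : ParamRange n d δ lam p ε B)
    (hℓ₀ : (n : ℝ) ≤ δ ^ (ℓ₀ - 1) * (d : ℝ) ^ (ℓ₀ - 1)) {k : ℕ} (hk : 10 * ℓ₀ ≤ k + 3) :
    (n : ℝ) ^ 2 ≤ (d * δ) ^ k := by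
  have hd := h.d_pos'
  have hδ := h.delta_pos
  have hd1 : (1 : ℝ) ≤ d := Nat.one_le_cast.2 h.d_pos
  have hδ1 : 1 ≤ δ := by linarith [h.log_le_delta, h.le_log]
  have h1 : 1 ≤ d * δ := by nlinarith
  calc (n : ℝ) ^ 2 ≤ (δ ^ (ℓ₀ - 1) * (d : ℝ) ^ (ℓ₀ - 1)) ^ 2 := pow_le_pow_left₀ h.n_pos.le hℓ₀ 2
    _ = (d * δ) ^ ((ℓ₀ - 1) * 2) := by rw [← mul_pow, mul_comm δ, ← pow_mul]
    _ ≤ (d * δ) ^ k := pow_le_pow_right₀ h1 (by omega)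

lemma expect_not_manyPaths_le (h : ParamRange n d δ lam p ε B)
    (hK : ∀ v, #{u | K.Adj v u} = d) (hℓ₀ : (n : ℝ) ≤ δ ^ (ℓ₀ - 1) * (d : ℝ) ^ (ℓ₀ - 1))
    (hℓ₀1 : 1 ≤ ℓ₀) :
    expect (edgeProb K p) (fun ω =>
        if ManyPaths (SimpleGraph.fromEdgeSet (ω : Set (Sym2 (Fin n)))) K d ℓ₀ δ lam then 0 else 1)
      ≤ 2 * Real.exp (-(98 * Real.log n)) := by
  have h0 := fun e => edgeProb_nonneg (K := K) h.p_pos.le e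
  have h1 := fun e => edgeProb_le_one (K := K) h.p_le e
  have hL := h.le_log
  have hN := h.n_pos
  set A : Fin n → Finset (Sym2 (Fin n)) → ℝ := fun x ω =>
    if (#(nbrs ω x) : ℝ) ≤ (1 - lam) * δ then 1 else 0 with hA
  set C : Fin n × Fin n × Finset (Fin n) × ℕ → Finset (Sym2 (Fin n)) → ℝ := fun q ω =>
    if (1 - lam) * δ < #(nbrs ω q.1) ∧
        (altPathCount (SimpleGraph.fromEdgeSet (ω : Set (Sym2 (Fin n)))) K (2 * (q.2.2.2 + 3))
          q.1 q.2.1 q.2.2.1 : ℝ)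
          < (1 - 100 * lam - (#((q.2.2.1 ∪ {q.1}) ∩ univ.filter (K.Adj q.2.1)) : ℝ) / d)
            * d ^ (q.2.2.2 + 3) * δ ^ (q.2.2.2 + 3) / n then 1 else 0 with hC
  set Zs : Finset (Finset (Fin n)) := univ.filter fun Z => (#Z : ℝ) ≤ 40 * Real.log n with hZs
  set T : Finset (Fin n × Fin n × Finset (Fin n) × ℕ) :=
    (univ ×ˢ univ ×ˢ Zs ×ˢ range n).filter fun q =>
      q.1 ≠ q.2.1 ∧ 10 * ℓ₀ ≤ q.2.2.2 + 3 ∧ (q.2.2.2 : ℝ) + 3 ≤ 10 * Real.log n with hT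
  have hA0 : ∀ x ω, 0 ≤ A x ω := fun x ω => by simp only [hA]; split_ifs <;> norm_num
  have hC0 : ∀ q ω, 0 ≤ C q ω := fun q ω => by simp only [hC]; split_ifs <;> norm_num
  have hpt : ∀ ω : Finset (Sym2 (Fin n)),
      (if ManyPaths (SimpleGraph.fromEdgeSet (ω : Set (Sym2 (Fin n)))) K d ℓ₀ δ lam
        then (0 : ℝ) else 1) ≤ ∑ x, A x ω + ∑ q ∈ T, C q ω := by
    intro ω
    have hS1 : 0 ≤ ∑ x, A x ω := sum_nonneg fun x _ => hA0 x ω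
    have hS2 : 0 ≤ ∑ q ∈ T, C q ω := sum_nonneg fun q _ => hC0 q ω
    split_ifs with hM
    · positivity
    · unfold ManyPaths at hM
      push Not at hM
      obtain ⟨x, y, hxy, Z, hZ, ℓ, hℓ1, hℓ2, hlt⟩ := hM
      obtain ⟨k, rfl⟩ : ∃ k, ℓ = k + 3 := ⟨ℓ - 3, by omega⟩
      by_cases hx : (#(nbrs ω x) : ℝ) ≤ (1 - lam) * δ
      · have h2 : A x ω = 1 := if_pos hx
        have h3 := single_le_sum (f := fun x => A x ω) (fun x _ => hA0 x ω) (mem_univ x)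
        simp only [h2] at h3
        linarith
      · have hZc : (Z.toFinset : Set (Fin n)) = Z := Set.coe_toFinset Z
        have hk : (k : ℝ) + 3 ≤ 10 * Real.log n := by
          push_cast at hℓ2
          exact hℓ2
        have hkn : k < n := by
          have hB := h.le_B
          have h3 : B ≤ n := le_trans (le_self_pow₀ (by linarith) (by norm_num)) h.B_pow
          have : (k : ℝ) < n := by linarith [h.log_le]
          exact_mod_cast this
        have hmem : ((x, y, Z.toFinset, k) : Fin n × Fin n × Finset (Fin n) × ℕ) ∈ T := by
          simp only [hT, hZs, mem_filter, mem_product, mem_univ, true_and, mem_range]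
          refine ⟨⟨?_, hkn⟩, hxy, hℓ1, hk⟩
          rw [← Set.ncard_eq_toFinset_card']
          exact hZ
        have hcard : #((Z.toFinset ∪ {x}) ∩ univ.filter (K.Adj y))
            = ((Z ∪ {x}) ∩ K.neighborSet y).ncard := by
          rw [← Set.ncard_coe_finset]
          congr 1
          ext v
          simp
        have h2 : C (x, y, Z.toFinset, k) ω = 1 := by
          simp only [hC]
          rw [if_pos]
          refine ⟨not_le.1 hx, ?_⟩
          rw [hcard, hZc]
          exact hlt
        have h3 := single_le_sum (f := fun q => C q ω) (fun q _ => hC0 q ω) hmem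
        simp only [h2] at h3
        linarith
  have hTcard : (#T : ℝ) ≤ Real.exp (40 * Real.log n ^ 2 + 4 * Real.log n) := by
    have h2 : #T ≤ n * (n * (#Zs * n)) := by
      refine (card_filter_le _ _).trans ?_
      simp only [card_product, card_univ, Fintype.card_fin, card_range]
      exact le_rfl
    have hn2 : 2 ≤ n := by
      have : (2 : ℝ) ≤ n := by
        have := Real.log_le_sub_one_of_pos hN
        linarith
      exact_mod_cast this
    have h3 : (#Zs : ℝ) ≤ Real.exp ((40 * Real.log n + 1) * Real.log n) :=
      card_small_finsets_le hn2 (by positivity)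
    calc (#T : ℝ) ≤ (n : ℝ) * (n * (#Zs * n)) := by exact_mod_cast h2
      _ ≤ n * (n * (Real.exp ((40 * Real.log n + 1) * Real.log n) * n)) := by gcongr
      _ = Real.exp (Real.log n) * (Real.exp (Real.log n)
          * (Real.exp ((40 * Real.log n + 1) * Real.log n) * Real.exp (Real.log n))) := by
          rw [Real.exp_log hN]
      _ = Real.exp (40 * Real.log n ^ 2 + 4 * Real.log n) := by
          rw [← Real.exp_add, ← Real.exp_add, ← Real.exp_add]
          ring_nf
  have hsumA : ∑ x, expect (edgeProb K p) (A x) ≤ Real.exp (-(98 * Real.log n)) := by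
    calc ∑ x, expect (edgeProb K p) (A x) ≤ ∑ _x : Fin n, Real.exp (-(100 * Real.log n)) :=
          sum_le_sum fun x _ => h.expect_card_nbrs_le_log hK x
      _ = Real.exp (Real.log n) * Real.exp (-(100 * Real.log n)) := by
          rw [sum_const, card_univ, Fintype.card_fin, nsmul_eq_mul, Real.exp_log hN]
      _ ≤ Real.exp (-(98 * Real.log n)) := by
          rw [← Real.exp_add]
          exact Real.exp_le_exp.2 (by linarith)
  have hsumC : ∑ q ∈ T, expect (edgeProb K p) (C q) ≤ Real.exp (-(98 * Real.log n)) := by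
    calc ∑ q ∈ T, expect (edgeProb K p) (C q) ≤ ∑ q ∈ T, Real.exp (-(100 * Real.log n ^ 2)) := by
          refine sum_le_sum fun q hq => ?_
          obtain ⟨hq1, hq2, hq3, hq4⟩ := mem_filter.1 hq
          have hqZ := (mem_filter.1 (mem_product.1 (mem_product.1 (mem_product.1 hq1).2).2).1).2
          exact h.expect_few_paths_le hK hq2 hqZ hq4 (h.sq_le_pow hℓ₀ hq3)
      _ = #T * Real.exp (-(100 * Real.log n ^ 2)) := by rw [sum_const, nsmul_eq_mul]
      _ ≤ Real.exp (40 * Real.log n ^ 2 + 4 * Real.log n) * Real.exp (-(100 * Real.log n ^ 2)) :=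
          mul_le_mul_of_nonneg_right hTcard (Real.exp_pos _).le
      _ ≤ Real.exp (-(98 * Real.log n)) := by
          rw [← Real.exp_add]
          exact Real.exp_le_exp.2 (by nlinarith)
  refine (expect_mono h0 h1 hpt).trans ?_
  rw [expect_add, expect_sum, expect_sum]
  linarith

end ParamRange

end UnionBound

section Transfer

open Finset

variable {d : ℕ} {K : SimpleGraph (Fin n)} {p : ℝ}

lemma edgeCount_eq_card_edgeFinset (G : SimpleGraph (Fin n)) : edgeCount G = #G.edgeFinset := by
  rw [edgeCount, ← SimpleGraph.coe_edgeFinset, Set.ncard_coe_finset]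

lemma card_filter_adj_of_isRegularGraph (hK : IsRegularGraph K d) (v : Fin n) :
    #{u | K.Adj v u} = d := by
  rw [← hK v, deg, Nat.card_coe_set_eq, ← Set.ncard_coe_finset]
  congr 1
  ext u
  simp

lemma bernoulliWeight_edgeFinset_sdiff {F : SimpleGraph (Fin n)} (hKF : K ≤ F) :
    bernoulliWeight (edgeProb K p) (F \ K).edgeFinset
      = p ^ (edgeCount F - edgeCount K) * (1 - p) ^ (n.choose 2 - edgeCount F) := by
  have h1 : ∀ e : Sym2 (Fin n),
      (if e ∈ (F \ K).edgeFinset then edgeProb K p e else 1 - edgeProb K p e)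
        = (if e ∈ F.edgeFinset \ K.edgeFinset then p else 1)
          * (if e ∈ (⊤ : SimpleGraph (Fin n)).edgeFinset \ F.edgeFinset then 1 - p else 1) := by
    intro e
    have hKF' : e ∈ K.edgeSet → e ∈ F.edgeSet := fun he => SimpleGraph.edgeSet_mono hKF he
    have hdiag : e ∈ F.edgeSet → ¬ e.IsDiag := fun he => SimpleGraph.not_isDiag_of_mem_edgeSet F he
    simp only [edgeProb, mem_sdiff, SimpleGraph.mem_edgeFinset, SimpleGraph.edgeSet_sdiff,
      Set.mem_sdiff, SimpleGraph.edgeSet_top, Set.mem_compl_iff, Sym2.mem_diagSet]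
    by_cases hK : e ∈ K.edgeSet
    · simp [hK, hKF' hK]
    · by_cases hF : e ∈ F.edgeSet
      · simp [hK, hF, hdiag hF]
      · by_cases hd : e.IsDiag <;> simp [hK, hF, hd]
  rw [bernoulliWeight, prod_congr rfl fun e _ => h1 e, prod_mul_distrib, prod_ite_mem, prod_ite_mem,
    univ_inter, univ_inter, prod_const, prod_const,
    card_sdiff_of_subset (SimpleGraph.edgeFinset_mono hKF),
    card_sdiff_of_subset (SimpleGraph.edgeFinset_mono le_top),
    SimpleGraph.card_edgeFinset_top_eq_card_choose_two, Fintype.card_fin,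
    edgeCount_eq_card_edgeFinset, edgeCount_eq_card_edgeFinset]

lemma sum_supergraph_weight_le (hp : 0 ≤ p) (hp1 : p ≤ 1) (P : SimpleGraph (Fin n) → Prop) :
    ∑ F : SimpleGraph (Fin n), (if K ≤ F ∧ P (F \ K) then
        p ^ (edgeCount F - edgeCount K) * (1 - p) ^ (n.choose 2 - edgeCount F) else 0)
      ≤ expect (edgeProb K p) (fun ω =>
        if P (SimpleGraph.fromEdgeSet (ω : Set (Sym2 (Fin n)))) then 1 else 0) := by
  have h0 := fun e => edgeProb_nonneg (K := K) hp e
  have h1 := fun e => edgeProb_le_one (K := K) hp1 e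
  rw [← sum_filter]
  have hinj : Set.InjOn (fun F : SimpleGraph (Fin n) => (F \ K).edgeFinset)
      ((univ.filter fun F => K ≤ F ∧ P (F \ K) : Finset (SimpleGraph (Fin n))) : Set _) := by
    intro F hF G hG hFG
    have h2 : F \ K = G \ K := by
      have := congrArg (fun s : Finset (Sym2 (Fin n)) => (s : Set (Sym2 (Fin n)))) hFG
      simp only [SimpleGraph.coe_edgeFinset] at this
      exact SimpleGraph.edgeSet_inj.1 this
    have hF' := (mem_filter.1 hF).2.1
    have hG' := (mem_filter.1 hG).2.1
    rw [← sdiff_sup_cancel hF', ← sdiff_sup_cancel hG', h2]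
  calc _ = ∑ F ∈ univ.filter fun F => K ≤ F ∧ P (F \ K),
        bernoulliWeight (edgeProb K p) (F \ K).edgeFinset
          * (if P (SimpleGraph.fromEdgeSet ((F \ K).edgeFinset : Set (Sym2 (Fin n))))
            then 1 else 0) := by
        refine sum_congr rfl fun F hF => ?_
        obtain ⟨hKF, hP⟩ := (mem_filter.1 hF).2
        rw [bernoulliWeight_edgeFinset_sdiff hKF, SimpleGraph.coe_edgeFinset,
          SimpleGraph.fromEdgeSet_edgeSet, if_pos hP, mul_one]
    _ = ∑ ω ∈ (univ.filter fun F => K ≤ F ∧ P (F \ K)).image fun F => (F \ K).edgeFinset,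
        bernoulliWeight (edgeProb K p) ω
          * (if P (SimpleGraph.fromEdgeSet (ω : Set (Sym2 (Fin n)))) then 1 else 0) :=
        by rw [sum_image hinj]
    _ ≤ _ := by
        refine sum_le_univ_sum_of_nonneg fun ω => mul_nonneg (bernoulliWeight_nonneg h0 h1 ω) ?_
        split_ifs <;> norm_num

/-- A property holding with probability at least `1 - η` for every fixed regular graph holds with
probability at least `1 - η` under the joint law. -/
lemma le_prEvent_of_expect_le {ν : PMF (SimpleGraph (Fin n) × SimpleGraph (Fin n))}
    (hν : IsRegAddGnp ν d p) (hp : 0 ≤ p) (hp1 : p ≤ 1) {η : ℝ} (hη : 0 ≤ η)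
    (P : SimpleGraph (Fin n) → SimpleGraph (Fin n) → Prop)
    (hP : ∀ K : SimpleGraph (Fin n), (∀ v, #{u | K.Adj v u} = d) →
      expect (edgeProb K p) (fun ω =>
        if P (SimpleGraph.fromEdgeSet (ω : Set (Sym2 (Fin n)))) K then 0 else 1) ≤ η) :
    ENNReal.ofReal (1 - η) ≤ prEvent ν fun w => P (w.2 \ w.1) w.1 := by
  set R : Finset (SimpleGraph (Fin n)) := univ.filter fun G => IsRegularGraph G d with hR
  have hRcard : {G : SimpleGraph (Fin n) | IsRegularGraph G d}.ncard = #R := by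
    rw [← Set.ncard_coe_finset, hR, coe_filter_univ]
  have hmem : ∀ {K}, K ∈ R ↔ IsRegularGraph K d := by simp [hR]
  have hcompl : prEvent ν (fun w => P (w.2 \ w.1) w.1) + prEvent ν (fun w => ¬ P (w.2 \ w.1) w.1)
      = 1 := by
    rw [prEvent, prEvent, ← ENNReal.tsum_add, ← ν.tsum_coe]
    refine tsum_congr fun w => ?_
    by_cases hw : P (w.2 \ w.1) w.1 <;> simp [hw]
  have hbad : prEvent ν (fun w => ¬ P (w.2 \ w.1) w.1) ≤ ENNReal.ofReal η := by
    have hK : ∀ K : SimpleGraph (Fin n),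
        ∑ F, (if P (F \ K) K then 0 else ν (K, F))
          ≤ if K ∈ R then (#R : ℝ≥0∞)⁻¹ * ENNReal.ofReal η else 0 := by
      intro K
      by_cases hKR : IsRegularGraph K d
      · rw [if_pos (hmem.2 hKR)]
        have h1 := sum_supergraph_weight_le (K := K) hp hp1 fun G => ¬ P G K
        replace h1 := h1.trans ((le_of_eq (congrArg (expect _) (funext fun ω => by
          by_cases hω : P (SimpleGraph.fromEdgeSet (ω : Set (Sym2 (Fin n)))) K <;> simp [hω]))).trans
            (hP K (card_filter_adj_of_isRegularGraph hKR)))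
        refine le_trans ?_ (mul_le_mul_right (ENNReal.ofReal_le_ofReal h1) _)
        rw [ENNReal.ofReal_sum_of_nonneg, mul_sum]
        · refine sum_le_sum fun F _ => ?_
          rw [hν (K, F), hRcard]
          by_cases hKF : K ≤ F <;> by_cases hPF : P (F \ K) K <;> simp [hKR, hKF, hPF]
        · intro F _
          have := sub_nonneg.2 hp1
          split_ifs <;> positivity
      · refine le_trans (le_of_eq (sum_eq_zero fun F _ => ?_)) (zero_le)
        rw [hν (K, F)]
        simp [hKR]
    rw [prEvent, tsum_fintype, Fintype.sum_prod_type]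
    refine (sum_le_sum fun K _ => le_trans (le_of_eq (sum_congr rfl fun F _ => ?_)) (hK K)).trans ?_
    · by_cases hPF : P (F \ K) K <;> simp [hPF]
    rw [sum_ite_mem, univ_inter, sum_const, nsmul_eq_mul, ← mul_assoc]
    exact mul_le_of_le_one_left (zero_le) (ENNReal.mul_inv_le_one _)
  rw [ENNReal.ofReal_sub _ hη, ENNReal.ofReal_one, ← hcompl]
  exact tsub_le_iff_right.2 (add_le_add_right hbad _)

end Transfer

section LargeN

open Filter

lemma eventually_large {ε μ c : ℝ} (hμ : 0 < μ) (hc : 0 < c) :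
    ∀ᶠ n : ℕ in atTop, 4 ≤ Real.log n ∧ 100 * Real.log n ≤ (n : ℝ) ^ (1 / 10 : ℝ) ∧
      Real.log n ≤ μ * (n : ℝ) ^ (1 / 20 : ℝ) ∧ 2 / ε ≤ (n : ℝ) ^ (9 / 100 : ℝ) ∧
      10 ≤ (n : ℝ) ^ (1 / 10 : ℝ) ∧ 2 ≤ c * n := by
  have hn : Tendsto (fun n : ℕ => (n : ℝ)) atTop atTop := tendsto_natCast_atTop_atTop
  have hlog : ∀ {a b : ℝ}, 0 < a → 0 < b → ∀ᶠ x : ℝ in atTop, Real.log x ≤ b * x ^ a := by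
    intro a b ha hb
    filter_upwards [(isLittleO_log_rpow_atTop ha).bound hb, eventually_ge_atTop 1] with x hx hx1
    rw [Real.norm_of_nonneg (Real.log_nonneg hx1), Real.norm_of_nonneg (by positivity)] at hx
    exact hx
  filter_upwards [hn.eventually (Real.tendsto_log_atTop.eventually_ge_atTop 4),
    hn.eventually (hlog (a := 1 / 10) (b := 1 / 100) (by norm_num) (by norm_num)),
    hn.eventually (hlog (a := 1 / 20) (by norm_num) hμ),
    hn.eventually ((tendsto_rpow_atTop (y := 9 / 100) (by norm_num)).eventually_ge_atTop (2 / ε)),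
    hn.eventually ((tendsto_rpow_atTop (y := 1 / 10) (by norm_num)).eventually_ge_atTop 10),
    hn.eventually (eventually_ge_atTop (2 / c))] with n h1 h2 h3 h4 h5 h6
  refine ⟨h1, by linarith, h3, h4, h5, ?_⟩
  rw [div_le_iff₀ hc] at h6
  linarith

lemma paramRange_of_large {ε σ μ : ℝ} (hε : 0 < ε) (hε1 : ε ≤ 1) (hσ : σ ≤ 1 / 100) (hμ : 0 < μ)
    (hlog : 4 ≤ Real.log n) (h1 : 100 * Real.log n ≤ (n : ℝ) ^ (1 / 10 : ℝ))
    (h2 : Real.log n ≤ μ * (n : ℝ) ^ (1 / 20 : ℝ)) (h3 : 2 / ε ≤ (n : ℝ) ^ (9 / 100 : ℝ))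
    (h4 : 10 ≤ (n : ℝ) ^ (1 / 10 : ℝ)) {d m : ℕ} (hd : 1 ≤ d)
    (hCd : 10 ^ 6 / ε * Real.log n ≤ d) (hm : ε * d * n ≤ m) (hm' : (m : ℝ) ≤ (n : ℝ) ^ (1 + σ))
    {δ lam p : ℝ} (hδ : δ = 2 * (m : ℝ) / n)
    (hlam : lam = max (μ ^ 2 / (Real.log n) ^ 2) (((n : ℝ) * Real.log n / m) ^ ((1 : ℝ) / 4)))
    (hp : p = (m : ℝ) / ((n.choose 2 : ℝ) - d * n / 2)) :
    ParamRange n d δ lam p ε ((n : ℝ) ^ (1 / 10 : ℝ)) := by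
  have hn0 : n ≠ 0 := by
    rintro rfl
    norm_num at hlog
  have hn : (0 : ℝ) < n := by positivity
  have hn1 : (1 : ℝ) ≤ n := Nat.one_le_cast.2 (Nat.one_le_iff_ne_zero.2 hn0)
  have hd0 : (0 : ℝ) < d := Nat.cast_pos.2 hd
  have hm0 : (0 : ℝ) < m := lt_of_lt_of_le (by positivity) hm
  have hδ0 : 0 < δ := by rw [hδ]; positivity
  set B : ℝ := (n : ℝ) ^ (1 / 10 : ℝ) with hB
  have hBpow : B ^ 10 = n := by
    rw [hB, ← Real.rpow_natCast, ← Real.rpow_mul hn.le]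
    norm_num
  have hmB : 2 / ε * (m / n) ≤ B := by
    have h5 : (m : ℝ) / n ≤ (n : ℝ) ^ (1 / 100 : ℝ) := by
      rw [div_le_iff₀ hn]
      refine hm'.trans ((Real.rpow_le_rpow_of_exponent_le hn1
        (by linarith : 1 + σ ≤ 1 / 100 + 1)).trans_eq ?_)
      rw [Real.rpow_add hn, Real.rpow_one]
    calc 2 / ε * (m / n) ≤ (n : ℝ) ^ (9 / 100 : ℝ) * (n : ℝ) ^ (1 / 100 : ℝ) := by gcongr
      _ = B := by
        rw [← Real.rpow_add hn, hB]
        norm_num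
  have hδB : δ ≤ B := by
    refine le_trans ?_ hmB
    rw [hδ, mul_div_assoc]
    refine mul_le_mul_of_nonneg_right ?_ (by positivity)
    rw [le_div_iff₀ hε]
    linarith
  have hdB : (d : ℝ) ≤ B := by
    refine le_trans ?_ hmB
    rw [div_mul_div_comm, le_div_iff₀ (by positivity)]
    linarith
  have hBn : 2 * B + 1 ≤ n := by
    rw [← hBpow]
    calc 2 * B + 1 ≤ B * B := by nlinarith
      _ = B ^ 2 := (sq B).symm
      _ ≤ B ^ 10 := pow_le_pow_right₀ (by linarith) (by norm_num)
  have hnd : 0 < (n : ℝ) - 1 - d := by linarith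
  have hpδ : p = δ / ((n : ℝ) - 1 - d) := by
    rw [hp, hδ, Nat.cast_choose_two,
      show (n : ℝ) * (n - 1) / 2 - d * n / 2 = n * (n - 1 - d) / 2 by ring]
    field_simp
  have hlam0 : 0 < lam := by
    rw [hlam]
    exact lt_max_of_lt_left (by positivity)
  refine ⟨hε, hε1, hd, ?_, ?_, ?_, hlam0, h4, hBpow.le, hdB, hδB, h1, ?_, hlog, ?_, ?_, ?_⟩
  · rw [hpδ]
    positivity
  · rw [hpδ, div_le_one hnd]
    linarith
  · rw [hpδ]
    field_simp
  · have h6 : μ ^ 2 / Real.log n ^ 2 ≤ lam := by rw [hlam]; exact le_max_left _ _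
    have h7 : Real.log n ^ 2 ≤ μ ^ 2 * B := by
      refine (pow_le_pow_left₀ (by linarith) h2 2).trans_eq ?_
      rw [mul_pow, hB, ← Real.rpow_natCast ((n : ℝ) ^ (1 / 20 : ℝ)), ← Real.rpow_mul hn.le]
      norm_num
    calc (1 : ℝ) ≤ μ ^ 2 / Real.log n ^ 2 * B := by
          rw [div_mul_eq_mul_div, le_div_iff₀ (by positivity)]
          linarith
      _ ≤ lam * B := mul_le_mul_of_nonneg_right h6 (by linarith)
  · rw [div_mul_eq_mul_div, div_le_iff₀ hε] at hCd
    linarith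
  · rw [hδ, le_div_iff₀ hn]
    linarith
  · have h6 : (n : ℝ) * Real.log n / m ≤ lam ^ 4 := by
      have h7 : 0 ≤ (n : ℝ) * Real.log n / m := by positivity
      calc (n : ℝ) * Real.log n / m = (((n : ℝ) * Real.log n / m) ^ ((1 : ℝ) / 4)) ^ 4 := by
            rw [← Real.rpow_natCast, ← Real.rpow_mul h7]
            norm_num
        _ ≤ lam ^ 4 := by
            refine pow_le_pow_left₀ (by positivity) ?_ 4
            rw [hlam]
            exact le_max_right _ _
    calc 2 * Real.log n = (n : ℝ) * Real.log n / m * δ := by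
          rw [hδ]
          field_simp
      _ ≤ lam ^ 4 * δ := mul_le_mul_of_nonneg_right h6 hδ0.le

lemma two_mul_exp_le {c : ℝ} (hc : 2 ≤ c * n) (hlog : 4 ≤ Real.log n) :
    2 * Real.exp (-(98 * Real.log n)) ≤ c / (n : ℝ) ^ 14 := by
  have hn0 : n ≠ 0 := by
    rintro rfl
    norm_num at hlog
  have hn : (0 : ℝ) < n := by positivity
  have hn1 : (1 : ℝ) ≤ n := Nat.one_le_cast.2 (Nat.one_le_iff_ne_zero.2 hn0)
  have hc0 : 0 < c := pos_of_mul_pos_left (by linarith) hn.le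
  have h1 : Real.exp (98 * Real.log n) = (n : ℝ) ^ 98 := by
    rw [show (98 : ℝ) * Real.log n = ((98 : ℕ) : ℝ) * Real.log n by norm_num, Real.exp_nat_mul,
      Real.exp_log hn]
  rw [Real.exp_neg, h1, le_div_iff₀ (by positivity), mul_assoc, ← div_eq_inv_mul]
  have h2 : (n : ℝ) ^ 14 / (n : ℝ) ^ 98 = ((n : ℝ) ^ 84)⁻¹ := by
    field_simp
  rw [h2, ← div_eq_mul_inv, div_le_iff₀ (by positivity)]
  exact hc.trans (mul_le_mul_of_nonneg_left (le_self_pow₀ hn1 (by norm_num)) hc0.le)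

end LargeN

/-- **Theorem 6.1.** There is `c* > 0` such that for every `ε ∈ (0,1]` there is `C₀ > 0`
such that for all `σ, μ ∈ (0,c*]` there is `C > 0` such that for every `c > 0` and all
sufficiently large `n`: with `d ∈ [n]`, `d ≥ C log n`, `dn` even, `ε d n ≤ m ≤ n^{1+σ}`,
`δ = 2m/n`, `λ = max{μ²/log²n, (n log n/m)^{1/4}}`, `p = m(binom(n,2) − dn/2)⁻¹`,
`(K,F)` with `K ~ G_d(n)` and `F = K + E`, and `ℓ₀` the smallest integer with
`δ^{ℓ₀−1} d^{ℓ₀−1} ≥ n`, with probability at least `1 − c n⁻¹⁴`: for all distinct `x, y`,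
every `Z` with `|Z| ≤ 40 log n` and every `10ℓ₀ ≤ ℓ ≤ 10 log n`, the number of
`(F∖K,K)`-alternating `x,y`-paths of length `2ℓ` avoiding `Z` internally is at least
`(1 − C₀λ − |(Z∪{x})∩N_K(y)|/d)·d^ℓ δ^ℓ/n`. -/
theorem lower_bound_switching_paths :
    ∃ cstar : ℝ, 0 < cstar ∧
      ∀ ε : ℝ, 0 < ε → ε ≤ 1 →
        ∃ C₀ : ℝ, 0 < C₀ ∧
          ∀ σ μ : ℝ, 0 < σ → σ ≤ cstar → 0 < μ → μ ≤ cstar →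
            ∃ C : ℝ, 0 < C ∧
              ∀ c : ℝ, 0 < c →
                ∃ n₀ : ℕ, ∀ n : ℕ, n₀ ≤ n →
                  ∀ d m : ℕ, 1 ≤ d → d ≤ n → C * Real.log n ≤ (d : ℝ) → Even (d * n) →
                    ε * d * n ≤ (m : ℝ) → (m : ℝ) ≤ (n : ℝ) ^ ((1 : ℝ) + σ) →
                    ∀ δ lam p : ℝ, δ = 2 * (m : ℝ) / n →
                      lam = max (μ ^ 2 / (Real.log n) ^ 2)
                        (((n : ℝ) * Real.log n / m) ^ ((1 : ℝ) / 4)) →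
                      p = (m : ℝ) / ((n.choose 2 : ℝ) - d * n / 2) →
                      ∀ ℓ₀ : ℕ,
                        IsLeast {L : ℕ | (n : ℝ) ≤ δ ^ (L - 1) * (d : ℝ) ^ (L - 1)} ℓ₀ →
                        ∀ ν : PMF (SimpleGraph (Fin n) × SimpleGraph (Fin n)),
                          IsRegAddGnp ν d p →
                          ENNReal.ofReal (1 - c / (n : ℝ) ^ 14) ≤
                            prEvent ν (fun w =>
                              ∀ x y : Fin n, x ≠ y →
                                ∀ Z : Set (Fin n), (Z.ncard : ℝ) ≤ 40 * Real.log n →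
                                  ∀ ℓ : ℕ, 10 * ℓ₀ ≤ ℓ → (ℓ : ℝ) ≤ 10 * Real.log n →
                                    (1 - C₀ * lam -
                                        (((Z ∪ {x}) ∩ w.1.neighborSet y).ncard : ℝ) / d) *
                                        (d : ℝ) ^ ℓ * δ ^ ℓ / n ≤
                                      (altPathCount (w.2 \ w.1) w.1 (2 * ℓ) x y Z : ℝ)) := by
  refine ⟨1 / 100, by norm_num, fun ε hε hε1 => ⟨100, by norm_num, fun σ μ _ hσ hμ _ =>
    ⟨10 ^ 6 / ε, by positivity, fun c hc => ?_⟩⟩⟩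
  obtain ⟨n₀, hn₀⟩ := Filter.eventually_atTop.1 (eventually_large (ε := ε) hμ hc)
  refine ⟨n₀, fun n hn d m hd _ hCd _ hm hm' δ lam p hδ hlam hp ℓ₀ hℓ₀ ν hν => ?_⟩
  obtain ⟨h1, h2, h3, h4, h5, h6⟩ := hn₀ n hn
  have h := paramRange_of_large hε hε1 hσ hμ h1 h2 h3 h4 h5 hd hCd hm hm' hδ hlam hp
  have hℓ₀1 : 1 ≤ ℓ₀ := by
    by_contra hlt
    obtain rfl : ℓ₀ = 0 := by omega
    have h7 : (n : ℝ) ≤ 1 := by simpa using hℓ₀.1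
    have h8 := Real.log_le_sub_one_of_pos h.n_pos
    linarith
  have hmain := le_prEvent_of_expect_le hν h.p_pos.le h.p_le (by positivity)
    (fun G K => ManyPaths G K d ℓ₀ δ lam)
    fun K hK => h.expect_not_manyPaths_le hK hℓ₀.1 hℓ₀1
  exact (ENNReal.ofReal_le_ofReal (sub_le_sub_left (two_mul_exp_le h6 h1) 1)).trans hmain

end Sandwich
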